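/- arXiv:1411.1379 — 8 statements merged into one kernel-verified Lean document; each statement's English description precedes it below -/
import Mathlib

section
/- For every integer $n \ge 2$ and every $\gamma > 0$, there exist $\varepsilon, \delta \in (0,1)$ and independent two-point value distributions — bidder $i$ has value $\varepsilon^{-i}$ with probability $\delta\varepsilon^{i}$ and value $0$ otherwise — such that the personalized posted-price benchmark equals $n\delta$, yet every symmetric, DSIC, ex-post IR digital-goods mechanism has expected revenue at most $\left(\frac{1}{1-\varepsilon} + \gamma n\right)\delta$. In particular, the optimal symmetric mechanism cannot guarantee an approximation better than $\Theta(n)$ to the optimal revenue. -/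
open MeasureTheory
open scoped ENNReal

/-- All bids are nonnegative. -/
def NonnegBids {n : ℕ} (v : Fin n → ℝ) : Prop := ∀ i, 0 ≤ v i

/-- Dominant strategy incentive compatibility of a digital-goods mechanism. -/
def IsDSIC {n : ℕ} (A P : (Fin n → ℝ) → Fin n → ℝ) : Prop :=
  ∀ v : Fin n → ℝ, NonnegBids v → ∀ (i : Fin n) (w : ℝ), 0 ≤ w →
    A (Function.update v i w) i * v i - P (Function.update v i w) i ≤
      A v i * v i - P v i

/-- Ex-post individual rationality. -/
def IsExPostIR {n : ℕ} (A P : (Fin n → ℝ) → Fin n → ℝ) : Prop :=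
  ∀ v : Fin n → ℝ, NonnegBids v → ∀ i : Fin n, 0 ≤ A v i * v i - P v i

/-- Anonymity (symmetry): permuting the bids permutes the outcome. -/
def IsAnonymous {n : ℕ} (Q : (Fin n → ℝ) → Fin n → ℝ) : Prop :=
  ∀ (π : Equiv.Perm (Fin n)) (v : Fin n → ℝ), NonnegBids v →
    ∀ i : Fin n, Q (v ∘ π) i = Q v (π i)

/-- Allocations lie in `[0,1]`. -/
def ValidAlloc {n : ℕ} (A : (Fin n → ℝ) → Fin n → ℝ) : Prop :=
  ∀ v : Fin n → ℝ, NonnegBids v → ∀ i : Fin n, 0 ≤ A v i ∧ A v i ≤ 1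

/-- The two-point distribution on `{x, 0}` with mass `w` at `x`. -/
noncomputable def twoPoint (w x : ℝ) : Measure ℝ :=
  ENNReal.ofReal w • Measure.dirac x + ENNReal.ofReal (1 - w) • Measure.dirac 0

theorem isProbabilityMeasure_twoPoint {w : ℝ} (hw0 : 0 ≤ w) (hw1 : w ≤ 1) (x : ℝ) :
    IsProbabilityMeasure (twoPoint w x) := by
  constructor
  simp only [twoPoint, Measure.add_apply, Measure.smul_apply, measure_univ, smul_eq_mul, mul_one]
  rw [← ENNReal.ofReal_add hw0 (by linarith)]
  simp

theorem integrable_twoPoint (w x : ℝ) (f : ℝ → ℝ) : Integrable f (twoPoint w x) :=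
  ((integrable_dirac (by simp)).smul_measure ENNReal.ofReal_ne_top).add_measure
    ((integrable_dirac (by simp)).smul_measure ENNReal.ofReal_ne_top)

theorem integral_twoPoint {w : ℝ} (hw0 : 0 ≤ w) (hw1 : w ≤ 1) (x : ℝ) (f : ℝ → ℝ) :
    ∫ y, f y ∂twoPoint w x = w * f x + (1 - w) * f 0 := by
  rw [twoPoint, integral_add_measure
    ((integrable_dirac (by simp)).smul_measure ENNReal.ofReal_ne_top)
    ((integrable_dirac (by simp)).smul_measure ENNReal.ofReal_ne_top)]
  simp [integral_smul_measure, hw0, hw1]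

theorem ae_twoPoint (w x : ℝ) : ∀ᵐ y ∂twoPoint w x, y = x ∨ y = 0 := by
  rw [twoPoint, ae_add_measure_iff]
  constructor <;> refine Measure.ae_smul_measure ?_ _ <;> simp [ae_dirac_eq]

theorem twoPoint_Ici_toReal {w p : ℝ} (hw0 : 0 ≤ w) (x : ℝ) (hp : 0 < p) :
    (twoPoint w x {y | p ≤ y}).toReal = if p ≤ x then w else 0 := by
  have h : MeasurableSet {y : ℝ | p ≤ y} := measurableSet_Ici
  simp only [twoPoint, Measure.add_apply, Measure.smul_apply, smul_eq_mul,
    Measure.dirac_apply' _ h, Set.indicator, Set.mem_ofPred_eq, if_neg hp.not_ge]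
  split_ifs <;> simp [hw0]

/-- The optimal posted-price revenue from a two-point distribution. -/
theorem iSup_posted_price_twoPoint {w x : ℝ} (hw0 : 0 ≤ w) (hx : 0 < x) :
    ⨆ (p : ℝ) (_ : 0 < p), p * (twoPoint w x {y | p ≤ y}).toReal = x * w := by
  have hle (p : ℝ) : ⨆ (_ : 0 < p), p * (twoPoint w x {y | p ≤ y}).toReal ≤ x * w := by
    by_cases hp : 0 < p
    · rw [ciSup_pos hp, twoPoint_Ici_toReal hw0 x hp]
      split_ifs with h
      · gcongr
      · simpa using by positivity
    · simp only [hp, Real.iSup_of_isEmpty]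
      positivity
  refine le_antisymm (ciSup_le hle) ?_
  refine le_trans (le_of_eq ?_) (le_ciSup ⟨x * w, Set.forall_mem_range.2 hle⟩ x)
  rw [ciSup_pos hx, twoPoint_Ici_toReal hw0 x hx, if_pos le_rfl]

/-- Under a product of two-point distributions, the integral of a product of functions of two
distinct coordinates factorizes. -/
theorem integral_pi_twoPoint_mul {n : ℕ} {w x : Fin n → ℝ} (hw0 : ∀ i, 0 ≤ w i)
    (hw1 : ∀ i, w i ≤ 1) {i j : Fin n} (hij : i ≠ j) (f g : ℝ → ℝ) :
    Integrable (fun v : Fin n → ℝ => f (v i) * g (v j))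
        (Measure.pi fun k => twoPoint (w k) (x k)) ∧
      ∫ v, f (v i) * g (v j) ∂(Measure.pi fun k => twoPoint (w k) (x k)) =
        (∫ y, f y ∂twoPoint (w i) (x i)) * ∫ y, g y ∂twoPoint (w j) (x j) := by
  have (k : Fin n) : IsProbabilityMeasure (twoPoint (w k) (x k)) :=
    isProbabilityMeasure_twoPoint (hw0 k) (hw1 k) _
  let F : Fin n → ℝ → ℝ := fun k => if k = i then f else if k = j then g else fun _ => 1
  have hprod (G : Fin n → ℝ) (hG : ∀ k, k ≠ i → k ≠ j → G k = 1) : ∏ k, G k = G i * G j := by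
    rw [← Finset.prod_pair hij]
    refine (Finset.prod_subset (Finset.subset_univ _) fun k _ hk => ?_).symm
    simp only [Finset.mem_insert, Finset.mem_singleton, not_or] at hk
    exact hG k hk.1 hk.2
  have hF : (fun v : Fin n → ℝ => f (v i) * g (v j)) = fun v => ∏ k, F k (v k) := by
    funext v
    rw [hprod (fun k => F k (v k)) fun k h1 h2 => by simp [F, h1, h2]]
    simp [F, hij.symm]
  constructor
  · rw [hF]
    exact Integrable.fintype_prod fun k => integrable_twoPoint _ _ _
  · rw [hF, integral_fintype_prod_eq_prod,
      hprod (fun k => ∫ y, F k y ∂twoPoint (w k) (x k)) fun k h1 h2 => by simp [F, h1, h2]]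
    simp [F, hij.symm]

/-- The largest payments a single-bidder mechanism with allocations `a k` at values
`(ε ^ (k + 1))⁻¹` can charge subject to incentive compatibility. -/
noncomputable def maxPayment (ε : ℝ) (a : ℕ → ℝ) (k : ℕ) : ℝ :=
  a 0 * (ε ^ 1)⁻¹ + ∑ j ∈ Finset.range k, (a (j + 1) - a j) * (ε ^ (j + 2))⁻¹

theorem maxPayment_nonneg {ε : ℝ} (hε : 0 < ε) {a : ℕ → ℝ} (ha : Monotone a) (ha0 : 0 ≤ a 0)
    (k : ℕ) : 0 ≤ maxPayment ε a k := by
  refine add_nonneg (by positivity) (Finset.sum_nonneg fun j _ => ?_)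
  exact mul_nonneg (sub_nonneg.2 (ha j.le_succ)) (by positivity)

theorem sum_pow_mul_maxPayment {ε : ℝ} (hε : 0 < ε) (a : ℕ → ℝ) (m : ℕ) :
    (1 - ε) * ∑ k ∈ Finset.range (m + 1), ε ^ (k + 1) * maxPayment ε a k
      + ε ^ (m + 2) * maxPayment ε a m = a m := by
  induction m with
  | zero =>
    simp only [maxPayment, Finset.sum_range_succ, Finset.sum_range_zero]
    field_simp
    ring
  | succ m ih =>
    have hQ : maxPayment ε a (m + 1) =
        maxPayment ε a m + (a (m + 1) - a m) * (ε ^ (m + 2))⁻¹ := by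
      simp only [maxPayment, Finset.sum_range_succ, add_assoc]
    have hc : ε ^ (m + 2) * (ε ^ (m + 2))⁻¹ = 1 := mul_inv_cancel₀ (by positivity)
    rw [Finset.sum_range_succ, hQ, show ε ^ (m + 1 + 2) = ε ^ (m + 2) * ε by ring]
    linear_combination ih + (a (m + 1) - a m) * hc

theorem sum_pow_mul_maxPayment_le {ε : ℝ} (hε : 0 < ε) (hε1 : ε < 1) {a : ℕ → ℝ}
    (ha : Monotone a) (ha0 : 0 ≤ a 0) (ha1 : ∀ k, a k ≤ 1) (n : ℕ) :
    ∑ k ∈ Finset.range n, ε ^ (k + 1) * maxPayment ε a k ≤ 1 / (1 - ε) := by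
  have h1 : 0 < 1 - ε := by linarith
  rcases n with _ | m
  · simpa using h1.le
  rw [le_div_iff₀' h1]
  have h := sum_pow_mul_maxPayment hε a m
  have h2 : 0 ≤ ε ^ (m + 2) * maxPayment ε a m :=
    mul_nonneg (by positivity) (maxPayment_nonneg hε ha ha0 m)
  linarith [ha1 m]

section Mechanism

variable {n : ℕ} {A P : (Fin n → ℝ) → Fin n → ℝ}

theorem nonnegBids_single (i : Fin n) {x : ℝ} (hx : 0 ≤ x) : NonnegBids (Pi.single i x) := by
  intro j
  by_cases h : j = i
  · subst h; simpa
  · simp [h]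

theorem IsAnonymous.single_eq {Q : (Fin n → ℝ) → Fin n → ℝ} (hQ : IsAnonymous Q) (i j : Fin n)
    {x : ℝ} (hx : 0 ≤ x) : Q (Pi.single i x) i = Q (Pi.single j x) j := by
  have h := hQ (Equiv.swap i j) (Pi.single j x) (nonnegBids_single j hx) i
  rw [Equiv.swap_apply_left] at h
  rw [← h]
  congr 1
  funext k
  simp only [Function.comp, Pi.single_apply]
  congr 1
  rw [Equiv.swap_apply_eq_iff, Equiv.swap_apply_right]

theorem payment_le_bid (hA : ValidAlloc A) (hIR : IsExPostIR A P) {v : Fin n → ℝ}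
    (hv : NonnegBids v) (i : Fin n) : P v i ≤ v i := by
  nlinarith [hA v hv i, hIR v hv i, hv i]

theorem IsDSIC.single (hIC : IsDSIC A P) (i : Fin n) {x y : ℝ} (hx : 0 ≤ x) (hy : 0 ≤ y) :
    A (Pi.single i y) i * x - P (Pi.single i y) i ≤
      A (Pi.single i x) i * x - P (Pi.single i x) i := by
  simpa [Pi.single, Function.update_idem] using
    hIC (Pi.single i x) (nonnegBids_single i hx) i y hy

/-- The allocation to a lone bidder is monotone in the bid. -/
theorem IsDSIC.alloc_single_mono (hIC : IsDSIC A P) (i : Fin n) {x y : ℝ} (hx : 0 ≤ x)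
    (hxy : x < y) : A (Pi.single i x) i ≤ A (Pi.single i y) i := by
  have h1 := hIC.single i hx (hx.trans hxy.le)
  have h2 := hIC.single i (hx.trans hxy.le) hx
  by_contra! h
  nlinarith [mul_pos (sub_pos.2 h) (sub_pos.2 hxy)]

theorem IsDSIC.payment_single_le_maxPayment (hIC : IsDSIC A P) (hIR : IsExPostIR A P)
    (i : Fin n) {ε : ℝ} (hε : 0 < ε) (k : ℕ) :
    P (Pi.single i (ε ^ (k + 1))⁻¹) i ≤
      maxPayment ε (fun m => A (Pi.single i (ε ^ (m + 1))⁻¹) i) k := by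
  induction k with
  | zero =>
    have h := hIR (Pi.single i (ε ^ 1)⁻¹) (nonnegBids_single i (by positivity)) i
    simpa [maxPayment] using h
  | succ k ih =>
    have h := hIC.single i (x := (ε ^ (k + 2))⁻¹) (y := (ε ^ (k + 1))⁻¹)
      (by positivity) (by positivity)
    simp only [maxPayment, Finset.sum_range_succ] at ih ⊢
    linarith

/-- Pointwise bound on a payment: a lone bidder pays at most `q`, and otherwise payments are
bounded by bids. -/
theorem payment_le_of_single_le (hA : ValidAlloc A) (hIR : IsExPostIR A P) {v : Fin n → ℝ}
    (hv : NonnegBids v) (i : Fin n) {q : ℝ} (hq : 0 ≤ q)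
    (hP : v i ≠ 0 → P (Pi.single i (v i)) i ≤ q) :
    P v i ≤ (if v i = 0 then 0 else q) +
      ∑ j ∈ Finset.univ.erase i, v i * (if v j = 0 then 0 else 1) := by
  have hle := payment_le_bid hA hIR hv i
  have hterm (j : Fin n) : 0 ≤ v i * (if v j = 0 then (0 : ℝ) else 1) :=
    mul_nonneg (hv i) (by split_ifs <;> norm_num)
  by_cases hi : v i = 0
  · simpa [hi] using hle
  rw [if_neg hi]
  by_cases hj : ∃ j, j ≠ i ∧ v j ≠ 0
  · obtain ⟨j, hji, hj⟩ := hj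
    have := Finset.single_le_sum (f := fun j => v i * (if v j = 0 then (0 : ℝ) else 1))
      (fun j _ => hterm j) (Finset.mem_erase.2 ⟨hji, Finset.mem_univ j⟩)
    simp only [hj, if_false, mul_one] at this
    linarith
  · push Not at hj
    have hsingle : Pi.single i (v i) = v := by
      funext k
      by_cases hk : k = i
      · subst hk; simp
      · simp [hk, hj k hk]
    have h := hP hi
    rw [hsingle] at h
    linarith [Finset.sum_nonneg fun j (_ : j ∈ Finset.univ.erase i) => hterm j]

/-- Revenue of a symmetric mechanism against the distributions with value `(ε ^ (i + 1))⁻¹` with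
probability `δ * ε ^ (i + 1)`. -/
theorem revenue_le (hn : 0 < n) {ε δ : ℝ} (hε : 0 < ε) (hε1 : ε < 1) (hδ : 0 < δ) (hδ1 : δ < 1)
    (hA : ValidAlloc A) (hPs : IsAnonymous P) (hIC : IsDSIC A P)
    (hIR : IsExPostIR A P) :
    ∫ v, ∑ i, P v i ∂(Measure.pi fun i : Fin n =>
        twoPoint (δ * ε ^ ((i : ℕ) + 1)) (ε ^ ((i : ℕ) + 1))⁻¹) ≤
      (1 / (1 - ε) + n * (δ * n)) * δ := by
  have h1ε : 0 < 1 - ε := by linarith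
  set w : Fin n → ℝ := fun i => δ * ε ^ ((i : ℕ) + 1) with hw
  set x : Fin n → ℝ := fun i => (ε ^ ((i : ℕ) + 1))⁻¹ with hx
  have hw0 (i) : 0 ≤ w i := by positivity
  have hwδ (i) : w i ≤ δ := mul_le_of_le_one_right hδ.le (pow_le_one₀ hε.le hε1.le)
  have hw1 (i) : w i ≤ 1 := (hwδ i).trans hδ1.le
  have hx0 (i) : 0 < x i := by positivity
  have hwx (i) : w i * x i = δ := by
    simp only [hw, hx]; field_simp
  have (i : Fin n) : IsProbabilityMeasure (twoPoint (w i) (x i)) :=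
    isProbabilityMeasure_twoPoint (hw0 i) (hw1 i) _
  let o : Fin n := ⟨0, hn⟩
  let a : ℕ → ℝ := fun k => A (Pi.single o (ε ^ (k + 1))⁻¹) o
  have hpow (k : ℕ) : 0 ≤ (ε ^ (k + 1))⁻¹ := by positivity
  have ha0 : 0 ≤ a 0 := (hA _ (nonnegBids_single o (hpow 0)) o).1
  have ha1 (k) : a k ≤ 1 := (hA _ (nonnegBids_single o (hpow k)) o).2
  have ha : Monotone a := monotone_nat_of_le_succ fun k =>
    hIC.alloc_single_mono o (hpow k) <|
      inv_strictAnti₀ (by positivity) (pow_lt_pow_right_of_lt_one₀ hε hε1 (by omega))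
  have hQ0 (k) : 0 ≤ maxPayment ε a k := maxPayment_nonneg hε ha ha0 k
  set μ := Measure.pi fun i => twoPoint (w i) (x i)
  let s : Fin n → (Fin n → ℝ) → ℝ := fun i v => if v i = 0 then 0 else maxPayment ε a i
  let t : Fin n → Fin n → (Fin n → ℝ) → ℝ := fun i j v => v i * (if v j = 0 then 0 else 1)
  have hbound : ∀ᵐ v ∂μ, ∑ i, P v i ≤ ∑ i, (s i v + ∑ j ∈ Finset.univ.erase i, t i j v) := by
    have hsupp : ∀ᵐ v ∂μ, ∀ i, v i = x i ∨ v i = 0 :=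
      Filter.eventually_all.2 fun i =>
        (Measure.tendsto_eval_ae_ae (μ := fun i => twoPoint (w i) (x i)) (i := i)).eventually
          (ae_twoPoint (w i) (x i))
    filter_upwards [hsupp] with v hv
    have hv0 : NonnegBids v := fun i => by
      rcases hv i with h | h <;> rw [h]
      exact (hx0 i).le
    refine Finset.sum_le_sum fun i _ => payment_le_of_single_le hA hIR hv0 i (hQ0 i) fun hi => ?_
    rw [(hv i).resolve_right hi, hPs.single_eq i o (hx0 i).le]
    exact hIC.payment_single_le_maxPayment hIR o hε i
  have hs (i) : Integrable (s i) μ ∧ ∫ v, s i v ∂μ = δ * (ε ^ ((i : ℕ) + 1) * maxPayment ε a i) := by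
    let f : ℝ → ℝ := fun y => if y = 0 then 0 else maxPayment ε a i
    have hf : Integrable f (twoPoint (w i) (x i)) := integrable_twoPoint _ _ _
    refine ⟨integrable_comp_eval (μ := fun i => twoPoint (w i) (x i)) hf, ?_⟩
    calc ∫ v, s i v ∂μ = ∫ y, f y ∂twoPoint (w i) (x i) :=
          integral_comp_eval (μ := fun i => twoPoint (w i) (x i)) hf.1
      _ = _ := by
          rw [integral_twoPoint (hw0 i) (hw1 i)]
          simp [f, (hx0 i).ne', hw, mul_assoc]
  have ht (i j) (hij : i ≠ j) : Integrable (t i j) μ ∧ ∫ v, t i j v ∂μ ≤ δ * δ := by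
    obtain ⟨h1, h2⟩ := integral_pi_twoPoint_mul (x := x) hw0 hw1 hij id
      (fun y => if y = 0 then 0 else 1)
    refine ⟨h1, h2.trans_le ?_⟩
    rw [integral_twoPoint (hw0 i) (hw1 i), integral_twoPoint (hw0 j) (hw1 j)]
    simp only [id, (hx0 j).ne', hwx, if_true, if_false, mul_zero, add_zero, mul_one]
    exact mul_le_mul_of_nonneg_left (hwδ j) hδ.le
  have htsum (i) : Integrable (fun v => ∑ j ∈ Finset.univ.erase i, t i j v) μ :=
    integrable_finsetSum _ fun j hj => (ht i j (Finset.ne_of_mem_erase hj).symm).1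
  by_cases hPint : Integrable (fun v => ∑ i, P v i) μ
  swap
  · rw [integral_undef hPint]
    positivity
  calc ∫ v, ∑ i, P v i ∂μ
      ≤ ∫ v, ∑ i, (s i v + ∑ j ∈ Finset.univ.erase i, t i j v) ∂μ :=
        integral_mono_ae hPint
          (integrable_finsetSum _ fun i _ => (hs i).1.add (htsum i)) hbound
    _ = ∑ i, (∫ v, s i v ∂μ + ∑ j ∈ Finset.univ.erase i, ∫ v, t i j v ∂μ) := by
        rw [integral_finsetSum (f := fun i v => s i v + ∑ j ∈ Finset.univ.erase i, t i j v) _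
          fun i _ => (hs i).1.add (htsum i)]
        refine Finset.sum_congr rfl fun i _ => ?_
        rw [integral_add (hs i).1 (htsum i), integral_finsetSum _ fun j hj =>
          (ht i j (Finset.ne_of_mem_erase hj).symm).1]
    _ ≤ ∑ i : Fin n, (δ * (ε ^ ((i : ℕ) + 1) * maxPayment ε a i) + n * (δ * δ)) := by
        refine Finset.sum_le_sum fun i _ => add_le_add (hs i).2.le ?_
        refine (Finset.sum_le_card_nsmul _ _ _ fun j hj =>
          (ht i j (Finset.ne_of_mem_erase hj).symm).2).trans ?_
        rw [nsmul_eq_mul]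
        gcongr
        simp
    _ = δ * ∑ k ∈ Finset.range n, ε ^ (k + 1) * maxPayment ε a k + n * (n * (δ * δ)) := by
        rw [Finset.sum_add_distrib, ← Finset.mul_sum,
          Fin.sum_univ_eq_sum_range (fun k => ε ^ (k + 1) * maxPayment ε a k)]
        simp
    _ ≤ δ * (1 / (1 - ε)) + n * (n * (δ * δ)) := by
        gcongr
        exact sum_pow_mul_maxPayment_le hε hε1 ha ha0 ha1 n
    _ = (1 / (1 - ε) + n * (δ * n)) * δ := by ring

end Mechanism

/-- **Optimal symmetric mechanism for general distributions: `Θ(n)` lower bound.**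
For every `n ≥ 2` and `γ > 0` there are `ε, δ ∈ (0,1)` and independent two-point
distributions (bidder `i` has value `ε^{-(i+1)}` with probability `δ·ε^{i+1}`, else `0`,
for `i : Fin n`) whose personalized posted-price benchmark equals `n·δ`, while every
symmetric, DSIC, ex-post IR digital-goods mechanism gets expected revenue at most
`(1/(1-ε) + γ·n)·δ`. -/
theorem symmetric_mechanism_linear_lower_bound
    (n : ℕ) (hn : 2 ≤ n) (γ : ℝ) (hγ : 0 < γ) :
    ∃ ε δ : ℝ, 0 < ε ∧ ε < 1 ∧ 0 < δ ∧ δ < 1 ∧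
      ∀ F : Fin n → Measure ℝ,
        (∀ i : Fin n,
          F i = ENNReal.ofReal (δ * ε ^ ((i : ℕ) + 1)) •
                  Measure.dirac ((ε ^ ((i : ℕ) + 1))⁻¹)
              + ENNReal.ofReal (1 - δ * ε ^ ((i : ℕ) + 1)) • Measure.dirac 0) →
        ((∑ i, ⨆ (p : ℝ) (_ : 0 < p), p * ((F i) {x | p ≤ x}).toReal) = n * δ ∧
        ∀ A P : (Fin n → ℝ) → Fin n → ℝ,
          (∀ i, Measurable fun v => A v i) → (∀ i, Measurable fun v => P v i) →
          ValidAlloc A → IsAnonymous A → IsAnonymous P →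
          IsDSIC A P → IsExPostIR A P →
          (∫ v, ∑ i, P v i ∂(Measure.pi F)) ≤ (1 / (1 - ε) + γ * n) * δ) := by
  have hn0 : (0 : ℝ) < n := by exact_mod_cast (by omega : 0 < n)
  obtain ⟨δ, hδ, hδ1, hδn⟩ : ∃ δ : ℝ, 0 < δ ∧ δ < 1 ∧ δ * n ≤ γ := by
    refine ⟨min (1 / 2) (γ / n), by positivity, (min_le_left _ _).trans_lt (by norm_num), ?_⟩
    exact (le_div_iff₀ hn0).1 (min_le_right _ _)
  refine ⟨1 / 2, δ, by norm_num, by norm_num, hδ, hδ1, fun F hF => ?_⟩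
  obtain rfl : F = fun i : Fin n =>
      twoPoint (δ * (1 / 2) ^ ((i : ℕ) + 1)) ((1 / 2) ^ ((i : ℕ) + 1))⁻¹ := funext hF
  refine ⟨?_, fun A P _ _ hA hAs hPs hIC hIR => ?_⟩
  · have h (i : Fin n) : ⨆ (p : ℝ) (_ : 0 < p), p * (twoPoint (δ * (1 / 2) ^ ((i : ℕ) + 1))
        ((1 / 2) ^ ((i : ℕ) + 1))⁻¹ {x | p ≤ x}).toReal = δ := by
      rw [iSup_posted_price_twoPoint (by positivity) (by positivity)]
      field_simp
    simp only [h]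
    simp
  · refine (revenue_le (by omega) (by norm_num) (by norm_num) hδ hδ1 hA hPs hIC hIR).trans ?_
    rw [mul_comm γ]
    gcongr
end

section
/- Fix an integer $n \ge 1$ and let $L = 2^{5n}$ and $N = (2^n - 1)L$. Consider $N$ independent bidders where, for each $i \in \{0,\dots,n-1\}$, exactly $2^{i}L$ bidders have values uniform on $[0, 2^{-i}]$. Then personalized posted prices (price $2^{-i-1}$ to each bidder uniform on $[0,2^{-i}]$) achieve expected revenue $nL/4$, while every symmetric, DSIC, ex-post IR digital-goods mechanism has expected revenue at most $L\,(2 + n^{2} e^{-2^{n-2}})$. Hence, for uniform distributions, the best symmetric mechanism achieves at most a $\Theta(\log N)$ approximation to the optimal revenue. -/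
open MeasureTheory
open scoped ENNReal

/-- The uniform distribution on `[0, 2^{-j}]`. -/
noncomputable def dyadicUniform (j : ℕ) : Measure ℝ :=
  ((2 : ℝ≥0∞) ^ j) • (volume.restrict (Set.Icc (0 : ℝ) (((2 : ℝ) ^ j)⁻¹)))

lemma dyadicUniform_real_of_inter {j : ℕ} {s t : Set ℝ} (hs : MeasurableSet s)
    (h : s ∩ Set.Icc (0 : ℝ) (((2 : ℝ) ^ j)⁻¹) = t) :
    (dyadicUniform j).real s = 2 ^ j * volume.real t := by
  simp [dyadicUniform, Measure.real, Measure.restrict_apply hs, h]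

instance (j : ℕ) : IsProbabilityMeasure (dyadicUniform j) := by
  constructor
  have h : ((2 : ℝ) ^ j)⁻¹ = ((2 : ℝ) ^ j)⁻¹ - 0 := by ring
  simp only [dyadicUniform, Measure.smul_apply, Measure.restrict_apply MeasurableSet.univ,
    Set.univ_inter, Real.volume_Icc, smul_eq_mul, sub_zero]
  rw [ENNReal.ofReal_inv_of_pos (by positivity), ENNReal.ofReal_pow (by norm_num)]
  simp only [ENNReal.ofReal_ofNat]
  exact ENNReal.mul_inv_cancel (by positivity) (by simp)

lemma dyadicUniform_real_Ici (j : ℕ) {p : ℝ} (hp : 0 ≤ p) :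
    (dyadicUniform j).real (Set.Ici p) = max (1 - 2 ^ j * p) 0 := by
  rw [dyadicUniform_real_of_inter measurableSet_Ici
    (t := Set.Icc p (((2 : ℝ) ^ j)⁻¹)) (by ext x; simp; grind), Measure.real, Real.volume_Icc,
    ENNReal.toReal_ofReal', mul_max_of_nonneg _ _ (by positivity)]
  congr 1
  · field_simp
  · simp

lemma dyadicUniform_real_Ioi (j : ℕ) {p : ℝ} (hp : 0 ≤ p) :
    (dyadicUniform j).real (Set.Ioi p) = max (1 - 2 ^ j * p) 0 := by
  rw [dyadicUniform_real_of_inter measurableSet_Ioi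
    (t := Set.Ioc p (((2 : ℝ) ^ j)⁻¹)) (by ext x; simp; grind), Measure.real, Real.volume_Ioc,
    ENNReal.toReal_ofReal', mul_max_of_nonneg _ _ (by positivity)]
  congr 1
  · field_simp
  · simp

lemma ae_dyadicUniform_mem_Icc (j : ℕ) : ∀ᵐ x ∂dyadicUniform j, x ∈ Set.Icc (0 : ℝ) 1 := by
  refine Measure.ae_smul_measure ?_ _
  filter_upwards [ae_restrict_mem measurableSet_Icc] with x hx
  exact ⟨hx.1, hx.2.trans (inv_le_one_of_one_le₀ (one_le_pow₀ (by norm_num)))⟩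

lemma dyadicUniform_restrict_Iic {j m : ℕ} (h : j ≤ m) :
    (dyadicUniform j).restrict (Set.Iic (((2 : ℝ) ^ m)⁻¹)) =
      ((2 : ℝ≥0∞) ^ (m - j))⁻¹ • dyadicUniform m := by
  have hpow : ((2 : ℝ) ^ m)⁻¹ ≤ ((2 : ℝ) ^ j)⁻¹ := by
    gcongr
    norm_num
  have hset : Set.Iic (((2 : ℝ) ^ m)⁻¹) ∩ Set.Icc 0 (((2 : ℝ) ^ j)⁻¹)
      = Set.Icc 0 (((2 : ℝ) ^ m)⁻¹) := by
    ext x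
    simp
    grind
  have hc : ((2 : ℝ≥0∞) ^ (m - j))⁻¹ * 2 ^ m = 2 ^ j := by
    obtain ⟨k, rfl⟩ := Nat.exists_eq_add_of_le h
    rw [Nat.add_sub_cancel_left, pow_add, mul_comm, mul_assoc,
      ENNReal.mul_inv_cancel (by positivity) (by simp), mul_one]
  rw [dyadicUniform, dyadicUniform, Measure.restrict_smul,
    Measure.restrict_restrict measurableSet_Iic, hset, smul_smul, hc]

lemma iSup_posted_price_dyadicUniform (j : ℕ) :
    (⨆ (p : ℝ) (_ : 0 < p), p * (dyadicUniform j {x | p ≤ x}).toReal) = (4 * 2 ^ j)⁻¹ := by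
  have hj : (0 : ℝ) < 2 ^ j := by positivity
  have key : ∀ p : ℝ, 0 < p →
      p * (dyadicUniform j {x | p ≤ x}).toReal = p * max (1 - 2 ^ j * p) 0 := fun p hp => by
    rw [← dyadicUniform_real_Ici j hp.le]
    rfl
  have hle : ∀ p : ℝ, (⨆ (_ : 0 < p), p * (dyadicUniform j {x | p ≤ x}).toReal)
      ≤ (4 * 2 ^ j)⁻¹ := fun p => by
    refine Real.iSup_le (fun hp => ?_) (by positivity)
    rw [key p hp]
    rcases max_cases (1 - 2 ^ j * p) 0 with ⟨h, -⟩ | ⟨h, -⟩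
    · rw [h, inv_eq_one_div, le_div_iff₀ (by positivity)]
      nlinarith [sq_nonneg (2 * 2 ^ j * p - 1)]
    · rw [h, mul_zero]
      positivity
  refine le_antisymm (Real.iSup_le hle (by positivity)) ?_
  have hp : (0 : ℝ) < (2 * 2 ^ j)⁻¹ := by positivity
  refine le_trans ?_ (le_ciSup ⟨_, Set.forall_mem_range.2 hle⟩ (2 * 2 ^ j)⁻¹)
  rw [ciSup_pos hp, key _ hp, max_eq_left]
  · apply le_of_eq
    field_simp
    norm_num
  · field_simp
    norm_num

lemma sum_pow_mul_max (n l : ℕ) (hl : l < n) :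
    ∑ j ∈ Finset.range n, (2 : ℝ) ^ j * max (1 - 2 ^ j * (2 ^ (l + 1))⁻¹) 0 ≤ 4 / 3 * 2 ^ l := by
  have hgeom : ∀ (x : ℝ) (m : ℕ), ∑ j ∈ Finset.range m, (2 : ℝ) ^ j * (1 - 2 ^ j * x) =
      2 ^ m - 1 - x * ((2 ^ m) ^ 2 - 1) / 3 := fun x m => by
    induction m with
    | zero => simp
    | succ m ih =>
      rw [Finset.sum_range_succ, ih]
      ring
  have hmax : ∀ j, max (1 - (2 : ℝ) ^ j * (2 ^ (l + 1))⁻¹) 0 =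
      if j < l + 1 then 1 - (2 : ℝ) ^ j * (2 ^ (l + 1))⁻¹ else 0 := fun j => by
    split_ifs with h
    · refine max_eq_left (sub_nonneg.2 (mul_inv_le_one_of_le₀ ?_ (by positivity)))
      exact pow_le_pow_right₀ (by norm_num) h.le
    · refine max_eq_right (sub_nonpos.2 ?_)
      rw [← div_eq_mul_inv, one_le_div (by positivity)]
      exact pow_le_pow_right₀ (by norm_num) (not_lt.1 h)
  have hrange : (Finset.range n).filter (· < l + 1) = Finset.range (l + 1) := by
    ext j
    simp
    omega
  simp only [hmax, mul_ite, mul_zero]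
  rw [← Finset.sum_filter, hrange, hgeom]
  have h1 : (1 : ℝ) ≤ 2 ^ l := one_le_pow₀ (by norm_num)
  have h2 : ((2 : ℝ) ^ (l + 1))⁻¹ * ((2 ^ (l + 1)) ^ 2 - 1) = 2 ^ (l + 1) - (2 ^ (l + 1))⁻¹ := by
    field_simp
  have h3 : ((2 : ℝ) ^ (l + 1))⁻¹ ≤ 1 := inv_le_one_of_one_le₀ (one_le_pow₀ (by norm_num))
  rw [h2]
  have h4 : (2 : ℝ) ^ (l + 1) = 2 * 2 ^ l := by ring
  linarith

/-- A monotone function is bounded on `[0, 1]` by its upper dyadic step function. -/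
lemma le_dyadic_step_sum {p : ℝ → ℝ} (hp : MonotoneOn p (Set.Icc 0 1)) (n : ℕ) {w : ℝ}
    (hw : w ∈ Set.Icc (0 : ℝ) 1) :
    p w ≤ p (2 ^ n)⁻¹ + ∑ l ∈ Finset.range n, (p (2 ^ l)⁻¹ - p (2 ^ (l + 1))⁻¹) *
      (Set.Ioi ((2 : ℝ) ^ (l + 1))⁻¹).indicator 1 w := by
  have hmem : ∀ m : ℕ, ((2 : ℝ) ^ m)⁻¹ ∈ Set.Icc (0 : ℝ) 1 := fun m =>
    ⟨by positivity, inv_le_one_of_one_le₀ (one_le_pow₀ (by norm_num))⟩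
  induction n with
  | zero => simpa using hp hw (by simp) hw.2
  | succ n ih =>
    rcases lt_or_ge ((2 : ℝ) ^ (n + 1))⁻¹ w with h | h
    · rw [Finset.sum_range_succ, Set.indicator_of_mem (Set.mem_Ioi.2 h)]
      simp only [Pi.one_apply]
      linarith
    · rw [Finset.sum_eq_zero fun l hl => ?_, add_zero]
      · exact hp hw (hmem _) h
      · rw [Set.indicator_of_notMem, mul_zero]
        rw [Set.mem_Ioi, not_lt]
        refine h.trans (inv_anti₀ (by positivity) (pow_le_pow_right₀ (by norm_num) ?_))
        have := Finset.mem_range.1 hl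
        omega

lemma sum_integral_dyadicUniform_le {a p : ℝ → ℝ}
    (ha : ∀ x ∈ Set.Icc (0 : ℝ) 1, a x ∈ Set.Icc (0 : ℝ) 1)
    (hic : ∀ x ∈ Set.Icc (0 : ℝ) 1, ∀ y ∈ Set.Icc (0 : ℝ) 1, a y * x - p y ≤ a x * x - p x)
    (hir : ∀ x ∈ Set.Icc (0 : ℝ) 1, p x ≤ a x * x)
    (hint : ∀ j, Integrable p (dyadicUniform j)) (n : ℕ) :
    ∑ j ∈ Finset.range n, 2 ^ j * ∫ x, p x ∂dyadicUniform j ≤ 4 / 3 := by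
  have hmem : ∀ m : ℕ, ((2 : ℝ) ^ m)⁻¹ ∈ Set.Icc (0 : ℝ) 1 := fun m =>
    ⟨by positivity, inv_le_one_of_one_le₀ (one_le_pow₀ (by norm_num))⟩
  have hmono : MonotoneOn p (Set.Icc 0 1) := by
    intro x hx y hy hxy
    have h1 := hic x hx y hy
    have h2 := hic y hy x hx
    rcases hxy.eq_or_lt with rfl | hlt
    · rfl
    have ham : a x ≤ a y := by
      by_contra! hcon
      nlinarith [mul_pos (sub_pos.2 hcon) (sub_pos.2 hlt)]
    nlinarith [mul_nonneg (sub_nonneg.2 ham) hx.1]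
  have hG : ∀ j, ∫ x, p x ∂dyadicUniform j ≤ p (2 ^ n)⁻¹ + ∑ l ∈ Finset.range n,
      (p (2 ^ l)⁻¹ - p (2 ^ (l + 1))⁻¹) * max (1 - 2 ^ j * (2 ^ (l + 1))⁻¹) 0 := fun j => by
    have hi : ∀ l ∈ Finset.range n, Integrable (fun w => (p (2 ^ l)⁻¹ - p (2 ^ (l + 1))⁻¹) *
        (Set.Ioi ((2 : ℝ) ^ (l + 1))⁻¹).indicator 1 w) (dyadicUniform j) := fun l _ =>
      ((integrable_const (1 : ℝ)).indicator measurableSet_Ioi).const_mul _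
    calc ∫ x, p x ∂dyadicUniform j
        ≤ ∫ w, (p (2 ^ n)⁻¹ + ∑ l ∈ Finset.range n, (p (2 ^ l)⁻¹ - p (2 ^ (l + 1))⁻¹) *
            (Set.Ioi ((2 : ℝ) ^ (l + 1))⁻¹).indicator 1 w) ∂dyadicUniform j := by
          refine integral_mono_ae (hint j)
            ((integrable_const _).add (integrable_finsetSum _ hi)) ?_
          filter_upwards [ae_dyadicUniform_mem_Icc j] with w hw
          exact le_dyadic_step_sum hmono n hw
      _ = _ := by
          rw [integral_add (integrable_const _) (integrable_finsetSum _ hi),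
            integral_finsetSum _ hi]
          simp only [integral_const, probReal_univ, one_smul]
          congr 1
          refine Finset.sum_congr rfl fun l _ => ?_
          rw [integral_const_mul, integral_indicator_one measurableSet_Ioi,
            dyadicUniform_real_Ioi j (by positivity)]
  have hstep : ∀ l, p (2 ^ l)⁻¹ - p (2 ^ (l + 1))⁻¹ ≤
      (2 ^ l)⁻¹ * (a (2 ^ l)⁻¹ - a (2 ^ (l + 1))⁻¹) := fun l => by
    have := hic _ (hmem l) _ (hmem (l + 1))
    linarith
  have hpow : ∑ j ∈ Finset.range n, (2 : ℝ) ^ j = 2 ^ n - 1 := by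
    rw [geom_sum_eq (by norm_num)]
    norm_num
  have ha0 := (ha _ (hmem 0)).2
  have han := ha _ (hmem n)
  have hbase : (2 ^ n - 1) * p (2 ^ n)⁻¹ ≤ a (2 ^ n)⁻¹ := by
    have h1 : (1 : ℝ) ≤ 2 ^ n := one_le_pow₀ (by norm_num)
    calc (2 ^ n - 1) * p (2 ^ n)⁻¹ ≤ (2 ^ n - 1) * (a (2 ^ n)⁻¹ * (2 ^ n)⁻¹) :=
          mul_le_mul_of_nonneg_left (hir _ (hmem n)) (by linarith)
      _ = a (2 ^ n)⁻¹ - a (2 ^ n)⁻¹ * (2 ^ n)⁻¹ := by field_simp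
      _ ≤ _ := sub_le_self _ (mul_nonneg han.1 (by positivity))
  calc ∑ j ∈ Finset.range n, 2 ^ j * ∫ x, p x ∂dyadicUniform j
      ≤ ∑ j ∈ Finset.range n, 2 ^ j * (p (2 ^ n)⁻¹ + ∑ l ∈ Finset.range n,
          (p (2 ^ l)⁻¹ - p (2 ^ (l + 1))⁻¹) * max (1 - 2 ^ j * (2 ^ (l + 1))⁻¹) 0) :=
        Finset.sum_le_sum fun j _ => mul_le_mul_of_nonneg_left (hG j) (by positivity)
    _ = (2 ^ n - 1) * p (2 ^ n)⁻¹ + ∑ l ∈ Finset.range n, (p (2 ^ l)⁻¹ - p (2 ^ (l + 1))⁻¹) *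
          ∑ j ∈ Finset.range n, 2 ^ j * max (1 - 2 ^ j * (2 ^ (l + 1))⁻¹) 0 := by
        simp only [mul_add, Finset.sum_add_distrib, Finset.mul_sum]
        rw [← Finset.sum_mul, hpow, Finset.sum_comm]
        congr 1
        refine Finset.sum_congr rfl fun l _ => Finset.sum_congr rfl fun j _ => by ring
    _ ≤ a (2 ^ n)⁻¹ + ∑ l ∈ Finset.range n,
          4 / 3 * (a (2 ^ l)⁻¹ - a (2 ^ (l + 1))⁻¹) := by
        refine add_le_add hbase (Finset.sum_le_sum fun l hl => ?_)
        have hle : ((2 : ℝ) ^ (l + 1))⁻¹ ≤ (2 ^ l)⁻¹ :=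
          inv_anti₀ (by positivity) (pow_le_pow_right₀ (by norm_num) (by omega))
        have h0 := sub_nonneg.2 (hmono (hmem (l + 1)) (hmem l) hle)
        refine (mul_le_mul_of_nonneg_left (sum_pow_mul_max n l (Finset.mem_range.1 hl)) h0).trans ?_
        refine (mul_le_mul_of_nonneg_right (hstep l) (by positivity)).trans (le_of_eq ?_)
        field_simp
    _ ≤ 4 / 3 := by
        rw [← Finset.mul_sum, Finset.sum_range_sub']
        linarith [han.1]

/-- The density of `dyadicUniform m` with respect to `dyadicUniform j`, for `j ≤ m`. -/
noncomputable def dyadicRatio (j m : ℕ) (x : ℝ) : ℝ :=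
  2 ^ (m - j) * (Set.Iic ((2 : ℝ) ^ m)⁻¹).indicator 1 x

lemma measurable_dyadicRatio (j m : ℕ) : Measurable (dyadicRatio j m) :=
  (measurable_one.indicator measurableSet_Iic).const_mul _

lemma dyadicRatio_nonneg (j m : ℕ) (x : ℝ) : 0 ≤ dyadicRatio j m x :=
  mul_nonneg (by positivity) (Set.indicator_nonneg (fun _ _ => zero_le_one) _)

lemma dyadicRatio_le (j m : ℕ) (x : ℝ) : dyadicRatio j m x ≤ 2 ^ (m - j) :=
  mul_le_of_le_one_right (by positivity) (Set.indicator_le_self' (fun _ _ => zero_le_one) _)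

lemma integral_dyadicRatio_mul {j m : ℕ} (h : j ≤ m) (f : ℝ → ℝ) :
    ∫ x, dyadicRatio j m x * f x ∂dyadicUniform j = ∫ x, f x ∂dyadicUniform m := by
  have : ∀ x, dyadicRatio j m x * f x =
      2 ^ (m - j) * (Set.Iic ((2 : ℝ) ^ m)⁻¹).indicator f x := fun x => by
    by_cases hx : x ∈ Set.Iic ((2 : ℝ) ^ m)⁻¹ <;> simp [dyadicRatio, hx]
  simp only [this]
  rw [integral_const_mul, integral_indicator measurableSet_Iic, dyadicUniform_restrict_Iic h,
    integral_smul_measure]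
  simp

lemma integral_dyadicRatio {j m : ℕ} (h : j ≤ m) :
    ∫ x, dyadicRatio j m x ∂dyadicUniform j = 1 := by
  simpa using integral_dyadicRatio_mul h fun _ => 1

lemma integrable_of_measurable_of_bound {α : Type*} [MeasurableSpace α] {μ : Measure α}
    [IsFiniteMeasure μ] {f : α → ℝ} (hf : Measurable f) {c : ℝ} (h0 : ∀ x, 0 ≤ f x)
    (hc : ∀ x, f x ≤ c) : Integrable f μ :=
  .of_bound hf.aestronglyMeasurable c (.of_forall fun x => by
    rw [Real.norm_of_nonneg (h0 x)]
    exact hc x)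

lemma integral_sq_dyadicRatio_le {j m : ℕ} (h : j ≤ m) :
    ∫ x, dyadicRatio j m x ^ 2 ∂dyadicUniform j ≤ 2 ^ (m - j) := by
  simp only [sq, integral_dyadicRatio_mul h]
  calc ∫ x, dyadicRatio j m x ∂dyadicUniform m ≤ ∫ _, 2 ^ (m - j) ∂dyadicUniform m :=
        integral_mono (integrable_of_measurable_of_bound (measurable_dyadicRatio j m)
          (dyadicRatio_nonneg j m) (dyadicRatio_le j m)) (integrable_const _) (dyadicRatio_le j m)
    _ = _ := by simp

lemma measurable_update_prod {ι : Type*} [DecidableEq ι] (i : ι) :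
    Measurable (fun p : (ι → ℝ) × ℝ => Function.update p.1 i p.2) := by
  rw [measurable_pi_iff]
  intro k
  by_cases h : k = i
  · subst h
    simpa using measurable_snd
  · simp only [Function.update_of_ne h]
    fun_prop

lemma measurable_integral_update {ι : Type*} [DecidableEq ι] (μ : Measure ℝ) [SFinite μ]
    (i : ι) {f : (ι → ℝ) → ℝ} (hf : Measurable f) :
    Measurable fun v => ∫ w, f (Function.update v i w) ∂μ :=
  ((hf.comp (measurable_update_prod i)).stronglyMeasurable.integral_prod_right').measurable

lemma integral_mem_Icc {α : Type*} [MeasurableSpace α] (μ : Measure α) [IsProbabilityMeasure μ]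
    {f : α → ℝ} (hf : Measurable f) (h : ∀ x, f x ∈ Set.Icc (0 : ℝ) 1) :
    ∫ x, f x ∂μ ∈ Set.Icc (0 : ℝ) 1 := by
  refine ⟨integral_nonneg fun x => (h x).1, ?_⟩
  calc ∫ x, f x ∂μ ≤ ∫ _, 1 ∂μ :=
        integral_mono (integrable_of_measurable_of_bound hf (fun x => (h x).1) fun x => (h x).2)
          (integrable_const _) fun x => (h x).2
    _ = 1 := by simp

section Product

variable {ι : Type*} [Fintype ι]

lemma integral_pi_eval (F : ι → Measure ℝ) [∀ i, IsProbabilityMeasure (F i)] (i : ι) {f : ℝ → ℝ}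
    (hf : Measurable f) : ∫ v, f (v i) ∂Measure.pi F = ∫ x, f x ∂F i := by
  rw [← (measurePreserving_eval F i).map_eq, integral_map (measurable_pi_apply i).aemeasurable
    hf.aestronglyMeasurable]

lemma integral_abs_sum_dyadicRatio_sub_le (g : ι → ℕ) {j m : ℕ} (h : j ≤ m) (s : Finset ι)
    (hs : ∀ i ∈ s, g i = j) {c : ℝ} (hc : 0 < c) :
    ∫ v, |∑ i ∈ s, dyadicRatio j m (v i) - s.card| ∂Measure.pi (fun i => dyadicUniform (g i)) ≤
      (s.card * 2 ^ (m - j) / c + c) / 2 := by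
  set μ := Measure.pi (fun i => dyadicUniform (g i)) with hμ
  have hθ := measurable_dyadicRatio j m
  have hmeas : ∀ i, Measurable fun v : ι → ℝ => dyadicRatio j m (v i) := fun i =>
    hθ.comp (measurable_pi_apply i)
  have hLp : ∀ i, MemLp (fun v : ι → ℝ => dyadicRatio j m (v i)) 2 μ := fun i =>
    .of_bound (hmeas i).aestronglyMeasurable (2 ^ (m - j)) (.of_forall fun v => by
      rw [Real.norm_of_nonneg (dyadicRatio_nonneg _ _ _)]
      exact dyadicRatio_le _ _ _)
  have hmean : ∫ v, (∑ i ∈ s, fun v : ι → ℝ => dyadicRatio j m (v i)) v ∂μ = s.card := by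
    simp only [Finset.sum_apply]
    rw [integral_finsetSum _ fun i _ => (hLp i).integrable (by norm_num)]
    rw [Finset.sum_congr rfl fun i hi => ?_, Finset.sum_const, nsmul_eq_mul, mul_one]
    rw [integral_pi_eval _ i hθ, hs i hi, integral_dyadicRatio h]
  have hsum : MemLp (∑ i ∈ s, fun v : ι → ℝ => dyadicRatio j m (v i)) 2 μ :=
    memLp_finsetSum' _ fun i _ => hLp i
  have hY : MemLp (fun v : ι → ℝ => ∑ i ∈ s, dyadicRatio j m (v i) - s.card) 2 μ := by
    convert! hsum.sub (memLp_const (s.card : ℝ)) using 1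
    ext v
    simp
  have hvar : ∫ v, (∑ i ∈ s, dyadicRatio j m (v i) - s.card) ^ 2 ∂μ ≤ s.card * 2 ^ (m - j) := by
    have hv := ProbabilityTheory.variance_eq_integral hsum.aemeasurable
    rw [hmean, ProbabilityTheory.IndepFun.variance_sum (fun i _ => hLp i)] at hv
    · simp only [Finset.sum_apply] at hv
      rw [← hv, ← nsmul_eq_mul]
      refine Finset.sum_le_card_nsmul _ _ _ fun i hi => ?_
      refine (ProbabilityTheory.variance_le_expectation_sq
        (hmeas i).aestronglyMeasurable).trans ?_
      simp only [Pi.pow_apply]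
      rw [integral_pi_eval _ i (hθ.pow_const 2), hs i hi]
      exact integral_sq_dyadicRatio_le h
    · intro i _ k _ hik
      exact (ProbabilityTheory.iIndepFun_pi (μ := fun i => dyadicUniform (g i))
        (X := fun _ => dyadicRatio j m) fun _ => hθ.aemeasurable).indepFun hik
  calc ∫ v, |∑ i ∈ s, dyadicRatio j m (v i) - s.card| ∂μ
      ≤ ∫ v, ((∑ i ∈ s, dyadicRatio j m (v i) - s.card) ^ 2 / c + c) / 2 ∂μ := by
        refine integral_mono (hY.integrable (by norm_num)).abs
          (((hY.integrable_sq.div_const c).add (integrable_const c)).div_const 2) fun v => ?_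
        simp only
        rw [le_div_iff₀ two_pos, ← sub_nonneg, ← sq_abs (_ - _)]
        set y := |∑ i ∈ s, dyadicRatio j m (v i) - (s.card : ℝ)|
        have : y ^ 2 / c + c - y * 2 = (y - c) ^ 2 / c := by
          field_simp
          ring
        rw [this]
        positivity
    _ = ((∫ v, (∑ i ∈ s, dyadicRatio j m (v i) - s.card) ^ 2 ∂μ) / c + c) / 2 := by
        rw [integral_div, integral_add (hY.integrable_sq.div_const c) (integrable_const c),
          integral_div]
        simp
    _ ≤ _ := by gcongr

variable [DecidableEq ι]

lemma map_update_pi_prod (F : ι → Measure ℝ)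
    [∀ i, IsProbabilityMeasure (F i)] (i : ι) :
    ((Measure.pi F).prod (F i)).map (fun p => Function.update p.1 i p.2) = Measure.pi F := by
  refine (Measure.pi_eq fun s hs => ?_).symm
  have : (fun p : (ι → ℝ) × ℝ => Function.update p.1 i p.2) ⁻¹' (Set.univ.pi s) =
      (Set.univ.pi (Function.update s i Set.univ)) ×ˢ s i := by
    ext p
    simp only [Set.mem_preimage, Set.mem_pi, Set.mem_univ, true_imp_iff, Set.mem_prod]
    constructor
    · intro h
      refine ⟨fun k => ?_, by simpa using h i⟩
      by_cases hk : k = i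
      · subst hk
        simp
      · simpa [Function.update_of_ne hk] using h k
    · rintro ⟨h, hi⟩ k
      by_cases hk : k = i
      · subst hk
        simpa
      · simpa [Function.update_of_ne hk] using h k
  rw [Measure.map_apply (measurable_update_prod i) (.univ_pi hs), this, Measure.prod_prod, Measure.pi_pi,
    ← Finset.mul_prod_erase _ _ (Finset.mem_univ i), ← Finset.mul_prod_erase _ (fun k => F k (s k))
      (Finset.mem_univ i), mul_comm]
  simp only [Function.update_self, measure_univ, one_mul]
  congr 1
  refine Finset.prod_congr rfl fun k hk => ?_
  rw [Function.update_of_ne (Finset.ne_of_mem_erase hk)]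

lemma integral_pi_update (F : ι → Measure ℝ) [∀ i, IsProbabilityMeasure (F i)] (i : ι)
    {f : (ι → ℝ) → ℝ} (hf : Measurable f) {c : ℝ} (h0 : ∀ v, 0 ≤ f v) (hc : ∀ v, f v ≤ c) :
    ∫ v, ∫ w, f (Function.update v i w) ∂F i ∂Measure.pi F = ∫ v, f v ∂Measure.pi F := by
  conv_rhs => rw [← map_update_pi_prod F i]
  rw [integral_map (measurable_update_prod i).aemeasurable hf.aestronglyMeasurable, integral_prod]
  exact integrable_of_measurable_of_bound (hf.comp (measurable_update_prod i))
    (fun _ => h0 _) (fun _ => hc _)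

/-- The payment of bidder `i` can be read off the reference bidder `z`, by reweighting with the
density of the value distribution of `z` and exchanging the two bidders. -/
lemma integral_exchange (g : ι → ℕ) {i z : ι} (h : g i ≤ g z) {Q : (ι → ℝ) → ι → ℝ}
    (hQm : ∀ i, Measurable fun v => Q v i) (hQ : ∀ v i, Q v i ∈ Set.Icc (0 : ℝ) 1)
    (hsym : ∀ (π : Equiv.Perm ι) v i, Q (v ∘ π) i = Q v (π i)) :
    ∫ v, (∫ t, Q (Function.update v z t) z ∂dyadicUniform (g i)) * dyadicRatio (g i) (g z) (v i)
      ∂Measure.pi (fun i => dyadicUniform (g i)) =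
    ∫ v, Q v i ∂Measure.pi (fun i => dyadicUniform (g i)) := by
  have hGm := measurable_integral_update (dyadicUniform (g i)) z (hQm z)
  have hG : ∀ v, ∫ t, Q (Function.update v z t) z ∂dyadicUniform (g i) ∈ Set.Icc (0 : ℝ) 1 :=
    fun v => integral_mem_Icc _ ((hQm z).comp (measurable_update v)) fun _ => hQ _ _
  have hm : Measurable fun v : ι → ℝ => (∫ t, Q (Function.update v z t) z ∂dyadicUniform (g i)) *
      dyadicRatio (g i) (g z) (v i) :=
    hGm.mul ((measurable_dyadicRatio _ _).comp (measurable_pi_apply i))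
  rw [← integral_pi_update (fun i => dyadicUniform (g i)) i hm (c := 1 * 2 ^ (g z - g i))
    (fun v => mul_nonneg (hG v).1 (dyadicRatio_nonneg _ _ _))
    (fun v => mul_le_mul (hG v).2 (dyadicRatio_le _ _ _) (dyadicRatio_nonneg _ _ _) zero_le_one)]
  simp only [Function.update_self]
  by_cases hiz : i = z
  · subst hiz
    simp only [Function.update_idem, integral_const_mul, integral_dyadicRatio h, mul_one]
    exact integral_pi_update (fun i => dyadicUniform (g i)) i (hQm i) (fun v => (hQ v i).1)
      fun v => (hQ v i).2
  have hswap : ∀ (v : ι → ℝ) (w t : ℝ), Q (Function.update (Function.update v i w) z t) z =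
      Q (Function.update (Function.update v i t) z w) i := fun v w t => by
    have : Function.update (Function.update v i w) z t =
        Function.update (Function.update v i t) z w ∘ Equiv.swap i z := by
      ext k
      by_cases hki : k = i
      · subst hki
        simp [hiz]
      by_cases hkz : k = z
      · subst hkz
        simp [hiz]
      simp [Equiv.swap_apply_of_ne_of_ne hki hkz, hki, hkz]
    rw [this, hsym, Equiv.swap_apply_right]
  have hQb := integral_pi_update (fun i => dyadicUniform (g i)) z (hQm i) (fun v => (hQ v i).1)
    fun v => (hQ v i).2
  have hQc := integral_pi_update (fun i => dyadicUniform (g i)) i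
    (measurable_integral_update (dyadicUniform (g z)) z (hQm i)) (c := 1)
    (fun v => integral_nonneg fun _ => (hQ _ _).1)
    (fun v => (integral_mem_Icc _ ((hQm i).comp (measurable_update v)) fun _ => hQ _ _).2)
  rw [← hQb, ← hQc]
  congr 1
  ext v
  simp only [hswap]
  simp_rw [mul_comm _ (dyadicRatio _ _ _)]
  rw [integral_dyadicRatio_mul h fun w =>
    ∫ t, Q (Function.update (Function.update v i t) z w) i ∂dyadicUniform (g i)]
  refine integral_integral_swap (f := fun w t =>
    Q (Function.update (Function.update v i t) z w) i) ?_
  refine integrable_of_measurable_of_bound (c := 1) ?_ (fun _ => (hQ _ _).1) fun _ => (hQ _ _).2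
  exact (hQm i).comp ((measurable_update_prod z).comp
    (((measurable_update v).comp measurable_snd).prodMk measurable_fst))

lemma sum_integral_symmetric_le {n L : ℕ} (hn : 1 ≤ n) (hL : L = 2 ^ (5 * n)) (g : ι → ℕ)
    (hg : ∀ i, g i < n)
    (hcard : ∀ j < n, (Finset.univ.filter fun i => g i = j).card = 2 ^ j * L)
    {Q : (ι → ℝ) → ι → ℝ}
    (hQm : ∀ i, Measurable fun v => Q v i) (hQ : ∀ v i, Q v i ∈ Set.Icc (0 : ℝ) 1)
    (hsym : ∀ (π : Equiv.Perm ι) v i, Q (v ∘ π) i = Q v (π i))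
    (hmenu : ∀ v z, ∑ j ∈ Finset.range n,
      2 ^ j * ∫ t, Q (Function.update v z t) z ∂dyadicUniform j ≤ 4 / 3) :
    ∑ i, ∫ v, Q v i ∂Measure.pi (fun i => dyadicUniform (g i)) ≤ 2 * L := by
  set μ := Measure.pi (fun i => dyadicUniform (g i)) with hμ
  obtain ⟨z, hz⟩ : ∃ z, g z = n - 1 := by
    have : 0 < (Finset.univ.filter fun i => g i = n - 1).card := by
      rw [hcard _ (by omega), hL]
      positivity
    obtain ⟨z, hz⟩ := Finset.card_pos.1 this
    exact ⟨z, (Finset.mem_filter.1 hz).2⟩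
  set G : ℕ → (ι → ℝ) → ℝ := fun j v => ∫ t, Q (Function.update v z t) z ∂dyadicUniform j
  have hGm : ∀ j, Measurable (G j) := fun j =>
    measurable_integral_update (dyadicUniform j) z (hQm z)
  have hG : ∀ j v, G j v ∈ Set.Icc (0 : ℝ) 1 := fun j v =>
    integral_mem_Icc _ ((hQm z).comp (measurable_update v)) fun _ => hQ _ _
  have hGi : ∀ j, Integrable (G j) μ := fun j =>
    integrable_of_measurable_of_bound (hGm j) (fun v => (hG j v).1) fun v => (hG j v).2
  have hθm : ∀ j i, Measurable fun v : ι → ℝ => dyadicRatio j (n - 1) (v i) := fun j i =>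
    (measurable_dyadicRatio _ _).comp (measurable_pi_apply i)
  have hGθ : ∀ j i, Integrable (fun v => G j v * dyadicRatio j (n - 1) (v i)) μ := fun j i =>
    integrable_of_measurable_of_bound ((hGm j).mul (hθm j i))
      (fun v => mul_nonneg (hG j v).1 (dyadicRatio_nonneg _ _ _))
      (fun v => mul_le_mul (hG j v).2 (dyadicRatio_le _ _ _) (dyadicRatio_nonneg _ _ _)
        zero_le_one)
  have hθi : ∀ j i, Integrable (fun v : ι → ℝ => dyadicRatio j (n - 1) (v i)) μ := fun j i =>
    integrable_of_measurable_of_bound (hθm j i) (fun v => dyadicRatio_nonneg _ _ _)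
      fun v => dyadicRatio_le _ _ _
  have hgroup : ∀ j ∈ Finset.range n, ∑ i ∈ Finset.univ.filter (fun i => g i = j),
      ∫ v, Q v i ∂μ ≤ L * (2 ^ j * ∫ v, G j v ∂μ) + 2 ^ (3 * n) := fun j hj => by
    have hjn := Finset.mem_range.1 hj
    set s := Finset.univ.filter (fun i => g i = j) with hs
    have hYi : Integrable (fun v => |∑ i ∈ s, dyadicRatio j (n - 1) (v i) - s.card|) μ :=
      ((integrable_finsetSum _ fun i _ => hθi j i).sub (integrable_const _)).abs
    have habs := integral_abs_sum_dyadicRatio_sub_le g (j := j) (m := n - 1) (by omega) s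
      (fun i hi => (Finset.mem_filter.1 hi).2) (c := 2 ^ (3 * n)) (by positivity)
    have hpow : (s.card : ℝ) * 2 ^ (n - 1 - j) / 2 ^ (3 * n) ≤ 2 ^ (3 * n) := by
      rw [div_le_iff₀ (by positivity), hcard j hjn, hL]
      push_cast
      rw [← pow_add, ← pow_add, ← pow_add]
      exact pow_le_pow_right₀ (by norm_num) (by omega)
    calc ∑ i ∈ s, ∫ v, Q v i ∂μ
        = ∑ i ∈ s, ∫ v, G j v * dyadicRatio j (n - 1) (v i) ∂μ := by
          refine Finset.sum_congr rfl fun i hi => ?_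
          have hij : g i = j := (Finset.mem_filter.1 hi).2
          have := integral_exchange g (i := i) (z := z) (by omega) hQm hQ hsym
          rw [hij, hz] at this
          exact this.symm
      _ = ∫ v, ∑ i ∈ s, G j v * dyadicRatio j (n - 1) (v i) ∂μ :=
          (integral_finsetSum _ fun i _ => hGθ j i).symm
      _ ≤ ∫ v, (s.card * G j v + |∑ i ∈ s, dyadicRatio j (n - 1) (v i) - s.card|) ∂μ := by
          refine integral_mono (integrable_finsetSum _ fun i _ => hGθ j i)
            (((hGi j).const_mul _).add hYi) fun v => ?_
          simp only [← Finset.mul_sum]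
          set y := ∑ i ∈ s, dyadicRatio j (n - 1) (v i)
          have h1 : G j v * (y - s.card) ≤ G j v * |y - s.card| :=
            mul_le_mul_of_nonneg_left (le_abs_self _) (hG j v).1
          have h2 : G j v * |y - s.card| ≤ |y - s.card| :=
            mul_le_of_le_one_left (abs_nonneg _) (hG j v).2
          linarith
      _ = s.card * ∫ v, G j v ∂μ +
          ∫ v, |∑ i ∈ s, dyadicRatio j (n - 1) (v i) - s.card| ∂μ := by
          rw [integral_add ((hGi j).const_mul _) hYi, integral_const_mul]
      _ ≤ _ := by
          have h3 : (s.card : ℝ) * ∫ v, G j v ∂μ = L * (2 ^ j * ∫ v, G j v ∂μ) := by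
            rw [hcard j hjn]
            push_cast
            ring
          linarith
  have hmain : ∑ j ∈ Finset.range n, 2 ^ j * ∫ v, G j v ∂μ ≤ 4 / 3 := by
    have hi : ∀ j ∈ Finset.range n, Integrable (fun v => 2 ^ j * G j v) μ := fun j _ =>
      (hGi j).const_mul _
    calc ∑ j ∈ Finset.range n, 2 ^ j * ∫ v, G j v ∂μ
        = ∫ v, ∑ j ∈ Finset.range n, 2 ^ j * G j v ∂μ := by
          rw [integral_finsetSum _ hi]
          simp only [integral_const_mul]
      _ ≤ ∫ _, 4 / 3 ∂μ :=
          integral_mono (integrable_finsetSum _ hi) (integrable_const _) fun v => hmenu v z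
      _ = 4 / 3 := by simp
  have herr : (n : ℝ) * 2 ^ (3 * n) ≤ L / 2 := by
    have h1 : n + 1 ≤ 2 ^ n := Nat.lt_two_pow_self
    have h2 : (2 : ℝ) ≤ 2 ^ n := by
      simpa using pow_le_pow_right₀ (a := (2 : ℝ)) (by norm_num) hn
    have h3 : (n : ℝ) + 1 ≤ 2 ^ n := by exact_mod_cast h1
    have h4 : (L : ℝ) = 2 ^ n * 2 ^ n * 2 ^ (3 * n) := by
      rw [hL]
      push_cast
      rw [← pow_add, ← pow_add]
      congr 1
      omega
    have h5 : (n : ℝ) ≤ 2 ^ n * 2 ^ n / 2 := by nlinarith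
    rw [h4, mul_div_right_comm]
    gcongr
  rw [← Finset.sum_fiberwise_of_maps_to (s := Finset.univ) (t := Finset.range n) (g := g)
    fun i _ => Finset.mem_range.2 (hg i)]
  refine (Finset.sum_le_sum hgroup).trans ?_
  rw [Finset.sum_add_distrib, ← Finset.mul_sum, Finset.sum_const, Finset.card_range, nsmul_eq_mul]
  have hL0 : (0 : ℝ) ≤ L := Nat.cast_nonneg L
  nlinarith [mul_le_mul_of_nonneg_left hmain hL0]

end Product

/-- Truncation of every bid to `[0, 1]`. -/
noncomputable def clipBids {ι : Type*} (v : ι → ℝ) (i : ι) : ℝ := max 0 (min (v i) 1)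

/-- The payments of a mechanism on truncated bids, normalized so that zero bids pay zero. -/
noncomputable def normalizedPayment {N : ℕ} (P : (Fin N → ℝ) → Fin N → ℝ) (v : Fin N → ℝ)
    (i : Fin N) : ℝ :=
  P (clipBids v) i - P (Function.update (clipBids v) i 0) i

section Mechanism

variable {N : ℕ} {A P : (Fin N → ℝ) → Fin N → ℝ}

lemma clipBids_mem_Icc (v : Fin N → ℝ) (i : Fin N) : clipBids v i ∈ Set.Icc (0 : ℝ) 1 :=
  ⟨le_max_left _ _, max_le zero_le_one (min_le_right _ _)⟩

lemma clipBids_of_mem_Icc {v : Fin N → ℝ} (h : ∀ i, v i ∈ Set.Icc (0 : ℝ) 1) :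
    clipBids v = v := by
  ext i
  rw [clipBids, min_eq_left (h i).2, max_eq_right (h i).1]

lemma measurable_clipBids : Measurable (clipBids : (Fin N → ℝ) → Fin N → ℝ) := by
  unfold clipBids
  fun_prop

lemma clipBids_update {v : Fin N → ℝ} {i : Fin N} {x : ℝ} (hx : x ∈ Set.Icc (0 : ℝ) 1) :
    clipBids (Function.update v i x) = Function.update (clipBids v) i x := by
  ext k
  by_cases hk : k = i
  · subst hk
    simp [clipBids, hx.1, hx.2]
  · simp [clipBids, hk]

lemma nonnegBids_update_clipBids (v : Fin N → ℝ) (i : Fin N) {x : ℝ} (hx : 0 ≤ x) :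
    NonnegBids (Function.update (clipBids v) i x) := fun k => by
  by_cases hk : k = i
  · subst hk
    simpa
  · simpa [hk] using (clipBids_mem_Icc v k).1

lemma normalizedPayment_update {v : Fin N → ℝ} {i : Fin N} {x : ℝ}
    (hx : x ∈ Set.Icc (0 : ℝ) 1) :
    normalizedPayment P (Function.update v i x) i =
      P (Function.update (clipBids v) i x) i - P (Function.update (clipBids v) i 0) i := by
  rw [normalizedPayment, clipBids_update hx, Function.update_idem]

lemma IsDSIC.update_clipBids (hA : IsDSIC A P) (v : Fin N → ℝ) (i : Fin N) {x y : ℝ}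
    (hx : 0 ≤ x) (hy : 0 ≤ y) :
    A (Function.update (clipBids v) i y) i * x - P (Function.update (clipBids v) i y) i ≤
      A (Function.update (clipBids v) i x) i * x - P (Function.update (clipBids v) i x) i := by
  simpa using hA _ (nonnegBids_update_clipBids v i hx) i y hy

lemma payment_zero_nonpos (hIR : IsExPostIR A P) (v : Fin N → ℝ) (i : Fin N) :
    P (Function.update (clipBids v) i 0) i ≤ 0 := by
  simpa using hIR _ (nonnegBids_update_clipBids v i le_rfl) i

lemma normalizedPayment_update_le (hVA : ValidAlloc A) (hIC : IsDSIC A P) (v : Fin N → ℝ)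
    (i : Fin N) {x : ℝ} (hx : x ∈ Set.Icc (0 : ℝ) 1) :
    normalizedPayment P (Function.update v i x) i ≤
      A (Function.update (clipBids v) i x) i * x := by
  rw [normalizedPayment_update hx]
  have h1 := hIC.update_clipBids v i hx.1 le_rfl
  have h2 := mul_nonneg (hVA _ (nonnegBids_update_clipBids v i le_rfl) i).1 hx.1
  linarith

lemma normalizedPayment_mem_Icc (hVA : ValidAlloc A) (hIC : IsDSIC A P) (v : Fin N → ℝ)
    (i : Fin N) : normalizedPayment P v i ∈ Set.Icc (0 : ℝ) 1 := by
  have hc := clipBids_mem_Icc v i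
  have hv : normalizedPayment P v i =
      normalizedPayment P (Function.update v i (clipBids v i)) i := by
    rw [normalizedPayment_update hc, Function.update_eq_self, normalizedPayment]
  rw [hv]
  constructor
  · rw [normalizedPayment_update hc]
    have := hIC.update_clipBids v i le_rfl hc.1
    linarith
  · have hA := hVA _ (nonnegBids_update_clipBids v i hc.1) i
    exact (normalizedPayment_update_le hVA hIC v i hc).trans (mul_le_one₀ hA.2 hc.1 hc.2)

lemma measurable_normalizedPayment (hP : ∀ i, Measurable fun v => P v i) (i : Fin N) :
    Measurable fun v => normalizedPayment P v i :=
  ((hP i).comp measurable_clipBids).sub ((hP i).comp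
    ((measurable_update_prod i).comp (measurable_clipBids.prodMk measurable_const)))

lemma normalizedPayment_comp_perm (hP : IsAnonymous P) (π : Equiv.Perm (Fin N))
    (v : Fin N → ℝ) (i : Fin N) :
    normalizedPayment P (v ∘ π) i = normalizedPayment P v (π i) := by
  have h1 : clipBids (v ∘ π) = clipBids v ∘ π := rfl
  have h2 : Function.update (clipBids v ∘ π) i 0 = Function.update (clipBids v) (π i) 0 ∘ π := by
    ext k
    by_cases hk : k = i
    · subst hk
      simp
    · simp [hk]
  rw [normalizedPayment, normalizedPayment, h1, h2, hP π _ fun k => (clipBids_mem_Icc v k).1,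
    hP π _ (nonnegBids_update_clipBids v _ le_rfl)]

lemma sum_integral_normalizedPayment_update_le (hP : ∀ i, Measurable fun v => P v i)
    (hVA : ValidAlloc A) (hIC : IsDSIC A P) (n : ℕ) (v : Fin N → ℝ) (i : Fin N) :
    ∑ j ∈ Finset.range n, 2 ^ j *
      ∫ t, normalizedPayment P (Function.update v i t) i ∂dyadicUniform j ≤ 4 / 3 := by
  refine sum_integral_dyadicUniform_le (a := fun x => A (Function.update (clipBids v) i x) i)
    (fun x hx => hVA _ (nonnegBids_update_clipBids v i hx.1) i) (fun x hx y hy => ?_)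
    (fun x hx => normalizedPayment_update_le hVA hIC v i hx) (fun j => ?_) n
  · rw [normalizedPayment_update hx, normalizedPayment_update hy]
    have := hIC.update_clipBids v i hx.1 hy.1
    linarith
  · have hQ := normalizedPayment_mem_Icc hVA hIC
    exact integrable_of_measurable_of_bound
      ((measurable_normalizedPayment hP i).comp (measurable_update v))
      (fun _ => (hQ _ _).1) fun _ => (hQ _ _).2

lemma integral_sum_payment_le (g : Fin N → ℕ) (hP : ∀ i, Measurable fun v => P v i)
    (hVA : ValidAlloc A) (hIC : IsDSIC A P) (hIR : IsExPostIR A P) :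
    ∫ v, ∑ i, P v i ∂Measure.pi (fun b => dyadicUniform (g b)) ≤
      ∑ i, ∫ v, normalizedPayment P v i ∂Measure.pi (fun b => dyadicUniform (g b)) := by
  have hQ := normalizedPayment_mem_Icc hVA hIC
  have hi : ∀ i, Integrable (fun v => normalizedPayment P v i)
      (Measure.pi (fun b => dyadicUniform (g b))) := fun i =>
    integrable_of_measurable_of_bound (measurable_normalizedPayment hP i)
      (fun _ => (hQ _ _).1) fun _ => (hQ _ _).2
  by_cases hint : Integrable (fun v => ∑ i, P v i) (Measure.pi (fun b => dyadicUniform (g b)))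
  · rw [← integral_finsetSum _ fun i _ => hi i]
    refine integral_mono_ae hint (integrable_finsetSum _ fun i _ => hi i) ?_
    have hae : ∀ᵐ v ∂Measure.pi (fun b => dyadicUniform (g b)),
        ∀ i, v i ∈ Set.Icc (0 : ℝ) 1 :=
      ae_all_iff.2 fun i => (Measure.quasiMeasurePreserving_eval
        (fun b => dyadicUniform (g b)) i).ae (ae_dyadicUniform_mem_Icc (g i))
    filter_upwards [hae] with v hv
    refine Finset.sum_le_sum fun i _ => ?_
    have := payment_zero_nonpos hIR v i
    rw [normalizedPayment, clipBids_of_mem_Icc hv] at *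
    linarith
  · rw [integral_undef hint]
    exact Finset.sum_nonneg fun i _ => integral_nonneg fun v => (hQ v i).1

end Mechanism

/-- **Uniform distributions counterexample.**
With `L = 2^(5n)`, `N = (2ⁿ-1)L` independent bidders, where for each `j < n`
exactly `2ʲL` bidders are uniform on `[0, 2^{-j}]` (bidder `b` belongs to group
`grp b`, and its distribution is Lebesgue measure on `[0, 2^{-grp b}]` rescaled
by `2^{grp b}`), personalized posted prices achieve expected revenue `n·L/4`,
while every symmetric, DSIC, ex-post IR digital-goods mechanism has expected
revenue at most `L·(2 + n²·e^{-2^{n-2}})`. -/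
theorem uniform_distributions_counterexample
    (n : ℕ) (hn : 1 ≤ n) (L N : ℕ)
    (hL : L = 2 ^ (5 * n)) (hN : N = (2 ^ n - 1) * L)
    (grp : Fin N → ℕ) (hgrp : ∀ b, grp b < n)
    (hcard : ∀ j < n, (Finset.univ.filter fun b => grp b = j).card = 2 ^ j * L)
    (F : Fin N → Measure ℝ)
    (hF : ∀ b, F b = ((2 : ℝ≥0∞) ^ grp b) •
        (volume.restrict (Set.Icc (0 : ℝ) (((2 : ℝ) ^ grp b)⁻¹)))) :
    ((∑ b, ⨆ (p : ℝ) (_ : 0 < p), p * ((F b) {x | p ≤ x}).toReal) = n * L / 4 ∧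
    ∀ A P : (Fin N → ℝ) → Fin N → ℝ,
      (∀ i, Measurable fun v => A v i) → (∀ i, Measurable fun v => P v i) →
      ValidAlloc A → IsAnonymous A → IsAnonymous P →
      IsDSIC A P → IsExPostIR A P →
      (∫ v, ∑ i, P v i ∂(Measure.pi F)) ≤
        L * (2 + n ^ 2 * Real.exp (-(2 : ℝ) ^ ((n : ℤ) - 2)))) := by
  obtain rfl : F = fun b => dyadicUniform (grp b) := funext hF
  refine ⟨?_, fun A P _ hP hVA _ hsymP hIC hIR => ?_⟩
  · simp only [iSup_posted_price_dyadicUniform]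
    rw [← Finset.sum_fiberwise_of_maps_to (s := Finset.univ) (t := Finset.range n) (g := grp)
      fun b _ => Finset.mem_range.2 (hgrp b)]
    rw [Finset.sum_congr rfl fun j hj => ?_, Finset.sum_const, Finset.card_range, nsmul_eq_mul,
      mul_div_assoc]
    rw [Finset.sum_congr rfl fun b hb => by rw [(Finset.mem_filter.1 hb).2], Finset.sum_const,
      hcard j (Finset.mem_range.1 hj), nsmul_eq_mul]
    push_cast
    field_simp
  · have hmain := sum_integral_symmetric_le hn hL grp hgrp hcard
      (measurable_normalizedPayment hP) (normalizedPayment_mem_Icc hVA hIC)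
      (normalizedPayment_comp_perm hsymP)
      (sum_integral_normalizedPayment_update_le hP hVA hIC n)
    have hnonneg : (0 : ℝ) ≤ L * (n ^ 2 * Real.exp (-(2 : ℝ) ^ ((n : ℤ) - 2))) := by positivity
    linarith [integral_sum_payment_le grp hP hVA hIC hIR]
end

section
/- Let $n \ge 1$ be an integer and let $h : \mathbb{R} \to [0,\infty)$ be an integrable function vanishing outside $(0,1]$ such that for every $t \in \{1,\dots,n-1\}$, every $x \in (2^{-t}, 2^{-(t-1)})$ and every $y \in (2^{-(t+1)}, 2^{-t}]$ satisfy $4\,h(x) \le h(y)$. Then for every $p \in [2^{-(n-1)}, 2)$ one has $\int_{(p,\infty)} h \;\le\; \frac{1}{2}\int_{(p/2,\infty)} h$. Consequently $p\int_{(p,\infty)} h \le \frac{p}{2}\int_{(p/2,\infty)} h$, i.e., a posted price of $p/2$ earns at least as much revenue as a posted price of $p$ against a buyer whose value has density $h$. -/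
open MeasureTheory

/-- If `4 * h x ≤ h (x / 2)` for almost every `x > p`, then the integral of `h` over `(p, ∞)` is at
most half its integral over `(p / 2, ∞)`. -/
theorem setIntegral_Ioi_le_half_of_ae {h : ℝ → ℝ} (hint : Integrable h) {p : ℝ}
    (hae : ∀ᵐ x, x ∈ Set.Ioi p → 4 * h x ≤ h (x / 2)) :
    (∫ x in Set.Ioi p, h x) ≤ (1 / 2) * (∫ x in Set.Ioi (p / 2), h x) := by
  have hscale := integral_comp_mul_left_Ioi h p (b := (1 / 2 : ℝ)) (by norm_num)
  rw [one_div_mul_eq_div, smul_eq_mul] at hscale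
  have hmono : (∫ x in Set.Ioi p, 4 * h x) ≤ ∫ x in Set.Ioi p, h (1 / 2 * x) := by
    refine setIntegral_mono_on_ae (hint.const_mul 4).integrableOn
      (hint.comp_mul_left' (by norm_num)).integrableOn measurableSet_Ioi ?_
    filter_upwards [hae] with x hx hxp
    simpa only [one_div_mul_eq_div] using hx hxp
  rw [integral_const_mul, hscale] at hmono
  linarith

/-- **Tail-halving induction of the low-price lemma.**
Let `h` be an integrable nonnegative density vanishing outside `(0,1]` such that for
every `t ∈ {1,…,n-1}` the density on `(2^{-t}, 2^{-(t-1)})` is at most a quarter of the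
density on `(2^{-(t+1)}, 2^{-t}]`.  Then for every `p ∈ [2^{-(n-1)}, 2)` the tail mass
beyond `p` is at most half the tail mass beyond `p/2`; consequently a posted price of
`p/2` earns at least as much revenue as a posted price of `p`. -/
theorem tail_halving
    (n : ℕ) (hn : 1 ≤ n) (h : ℝ → ℝ)
    (hint : Integrable h) (hnonneg : ∀ x, 0 ≤ h x)
    (hvanish : ∀ x, x ∉ Set.Ioc (0 : ℝ) 1 → h x = 0)
    (hquarter : ∀ t : ℕ, 1 ≤ t → t ≤ n - 1 →
      ∀ x ∈ Set.Ioo ((2 : ℝ) ^ (-(t : ℤ))) ((2 : ℝ) ^ (-(t : ℤ) + 1)),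
      ∀ y ∈ Set.Ioc ((2 : ℝ) ^ (-(t : ℤ) - 1)) ((2 : ℝ) ^ (-(t : ℤ))),
        4 * h x ≤ h y) :
    ∀ p : ℝ, (2 : ℝ) ^ (-((n : ℤ) - 1)) ≤ p → p < 2 →
      (∫ x in Set.Ioi p, h x) ≤ (1 / 2) * (∫ x in Set.Ioi (p / 2), h x) ∧
      p * (∫ x in Set.Ioi p, h x) ≤ (p / 2) * (∫ x in Set.Ioi (p / 2), h x) := by
  intro p hp _
  have hp0 : 0 < p := lt_of_lt_of_le (by positivity) hp
  have key : (∫ x in Set.Ioi p, h x) ≤ (1 / 2) * (∫ x in Set.Ioi (p / 2), h x) := by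
    refine setIntegral_Ioi_le_half_of_ae hint ?_
    filter_upwards [(Set.countable_range fun k : ℤ => (2 : ℝ) ^ k).ae_notMem volume]
      with x hxd hxp
    have hxp' : p < x := hxp
    by_cases hx1 : 1 < x
    · rw [hvanish x fun hx => absurd hx.2 (not_le.mpr hx1), mul_zero]
      exact hnonneg _
    obtain ⟨k, hk, hk'⟩ := exists_mem_Ico_zpow (hp0.trans hxp') (one_lt_two (α := ℝ))
    have hne : (2 : ℝ) ^ k < x := lt_of_le_of_ne hk fun h => hxd ⟨k, h⟩
    have hk0 : k < 0 := by
      rw [← zpow_lt_zpow_iff_right₀ (one_lt_two (α := ℝ)), zpow_zero]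
      exact hne.trans_le (not_lt.mp hx1)
    have hkn : -((n : ℤ) - 1) < k + 1 := by
      rw [← zpow_lt_zpow_iff_right₀ (one_lt_two (α := ℝ))]
      exact (hp.trans_lt hxp').trans hk'
    obtain ⟨t, rfl⟩ : ∃ t : ℕ, k = -(t : ℤ) := ⟨k.natAbs, by omega⟩
    refine hquarter t (by omega) (by omega) x ⟨hne, hk'⟩ (x / 2) ⟨?_, ?_⟩
    · rw [zpow_sub_one₀ two_ne_zero]
      linarith
    · rw [zpow_add_one₀ two_ne_zero] at hk'
      linarith
  refine ⟨key, (mul_le_mul_of_nonneg_left key hp0.le).trans_eq (by ring)⟩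
end

section
/- Fix an integer $n \ge 1$, let $L = 2^{5n}$, and consider $N = (2^n-1)L$ independent bidders where for each $j \in \{0,\dots,n-1\}$ exactly $2^{j}L$ bidders have values uniform on $[0,2^{-j}]$. For $i \in \{1,\dots,n-1\}$ let $b_i$ be the number of bidders whose value exceeds $2^{-i}$. Then $\Pr\left[\exists\, i \in \{1,\dots,n-1\}:\; b_i \le \left(\tfrac{2}{3}2^{i}-1\right)L + 1\right] \;\le\; n\, e^{-2^{\,n-2}}$. -/
open MeasureTheory
open scoped ENNReal Classical

/-- Hoeffding's lower tail bound for the number of coordinates falling into a measurable set. -/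
lemma measureReal_card_le_sub_le_exp {ι α : Type*} [Fintype ι] [MeasurableSpace α]
    (μ : ι → Measure α) [∀ i, IsProbabilityMeasure (μ i)] {S : Set α} (hS : MeasurableSet S)
    {ε : ℝ} (hε : 0 ≤ ε) :
    (Measure.pi μ).real {v | ((Finset.univ.filter fun i => v i ∈ S).card : ℝ) ≤
        ∑ i, (μ i).real S - ε} ≤ Real.exp (-(2 * ε ^ 2 / Fintype.card ι)) := by
  have hmeas : Measurable (S.indicator fun _ => (1 : ℝ)) := measurable_const.indicator hS
  have hindep : ProbabilityTheory.iIndepFun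
      (fun i (v : ι → α) => (μ i).real S - S.indicator (fun _ => (1 : ℝ)) (v i))
      (Measure.pi μ) :=
    ProbabilityTheory.iIndepFun_pi
      (X := fun i x => (μ i).real S - S.indicator (fun _ => (1 : ℝ)) x)
      fun i => (hmeas.const_sub _).aemeasurable
  have hsub (i : ι) : ProbabilityTheory.HasSubgaussianMGF
      (fun v : ι → α => (μ i).real S - S.indicator (fun _ => (1 : ℝ)) (v i))
      ((‖(μ i).real S - ((μ i).real S - 1)‖₊ / 2) ^ 2) (Measure.pi μ) := by
    refine ProbabilityTheory.hasSubgaussianMGF_of_mem_Icc_of_integral_eq_zero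
      ((hmeas.comp (measurable_pi_apply i)).const_sub _).aemeasurable (.of_forall fun v => ?_) ?_
    · by_cases h : v i ∈ S <;> simp [h]
    · rw [integral_comp_eval (μ := μ) (i := i) (f := fun x : α => (μ i).real S - S.indicator (fun _ => (1 : ℝ)) x)
          (hmeas.const_sub _).aestronglyMeasurable,
        integral_sub (integrable_const _) ((integrable_const _).indicator hS)]
      simp [integral_indicator hS]
  have key := ProbabilityTheory.HasSubgaussianMGF.measure_sum_ge_le_of_iIndepFun hindep
    (s := Finset.univ) (fun i _ => hsub i) hε
  convert key using 2
  · congr 1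
    ext v
    simp only [Finset.sum_sub_distrib, Finset.card_filter, Nat.cast_sum,
      Set.indicator_apply, Nat.cast_ite, Nat.cast_one, Nat.cast_zero]
    constructor <;> intro h <;> linarith
  · simp
    ring

lemma real_uniform_Ioi {j i : ℕ} :
    (((2 : ℝ≥0∞) ^ j) • (volume.restrict (Set.Icc (0 : ℝ) (((2 : ℝ) ^ j)⁻¹)))).real
      (Set.Ioi (((2 : ℝ) ^ i)⁻¹)) = max 0 (1 - 2 ^ j / 2 ^ i) := by
  have hset : Set.Ioi (((2 : ℝ) ^ i)⁻¹) ∩ Set.Icc (0 : ℝ) (((2 : ℝ) ^ j)⁻¹) =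
      Set.Ioc (((2 : ℝ) ^ i)⁻¹) (((2 : ℝ) ^ j)⁻¹) := by
    ext x
    have : 0 < ((2 : ℝ) ^ i)⁻¹ := by positivity
    simp only [Set.mem_inter_iff, Set.mem_Ioi, Set.mem_Icc, Set.mem_Ioc]
    exact ⟨fun h => ⟨h.1, h.2.2⟩, fun h => ⟨h.1, (this.trans h.1).le, h.2⟩⟩
  rw [measureReal_ennreal_smul_apply, measureReal_restrict_apply measurableSet_Ioi, hset,
    Measure.real, Real.volume_Ioc, ENNReal.toReal_ofReal', ENNReal.toReal_pow,
    ENNReal.toReal_ofNat, mul_max_of_nonneg _ _ (by positivity), max_comm]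
  congr 1
  · simp
  · field_simp

lemma isProbabilityMeasure_uniform (j : ℕ) :
    IsProbabilityMeasure
      (((2 : ℝ≥0∞) ^ j) • (volume.restrict (Set.Icc (0 : ℝ) (((2 : ℝ) ^ j)⁻¹)))) := by
  constructor
  have h : (2 : ℝ≥0∞) ^ j = ENNReal.ofReal (2 ^ j) := by
    rw [ENNReal.ofReal_pow zero_le_two, ENNReal.ofReal_ofNat]
  rw [Measure.smul_apply, Measure.restrict_apply_univ, Real.volume_Icc, smul_eq_mul, h,
    ← ENNReal.ofReal_mul (by positivity)]
  simp

lemma sum_two_pow_mul_one_sub (i : ℕ) :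
    ∑ j ∈ Finset.range i, (2 : ℝ) ^ j * (1 - 2 ^ j / 2 ^ i) =
      2 / 3 * 2 ^ i - 1 + (2 ^ i)⁻¹ / 3 := by
  have h (i : ℕ) (c : ℝ) : ∑ j ∈ Finset.range i, (2 : ℝ) ^ j * (1 - 2 ^ j / c) =
      2 ^ i - 1 - ((2 ^ i) ^ 2 - 1) / 3 / c := by
    induction i with
    | zero => simp
    | succ k ih => rw [Finset.sum_range_succ, ih]; ring
  rw [h]
  field_simp
  ring

/-- The expected number of bidders exceeding `2⁻ⁱ`. -/
lemma sum_real_uniform_Ioi {ι : Type*} [Fintype ι] {n L i : ℕ} (grp : ι → ℕ)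
    (hgrp : ∀ b, grp b < n)
    (hcard : ∀ j < n, (Finset.univ.filter fun b => grp b = j).card = 2 ^ j * L) (hi : i ≤ n) :
    ∑ b, max 0 (1 - (2 : ℝ) ^ grp b / 2 ^ i) =
      (2 / 3 * 2 ^ i - 1 + (2 ^ i)⁻¹ / 3) * L := by
  rw [← Finset.sum_fiberwise_of_maps_to (s := Finset.univ) (t := Finset.range n) (g := grp)
    fun b _ => Finset.mem_range.2 (hgrp b)]
  have hfiber (j : ℕ) (hj : j ∈ Finset.range n) :
      ∑ b with grp b = j, max 0 (1 - (2 : ℝ) ^ grp b / 2 ^ i) =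
        2 ^ j * L * max 0 (1 - 2 ^ j / 2 ^ i) := by
    rw [Finset.sum_congr rfl (g := fun _ => max 0 (1 - (2 : ℝ) ^ j / 2 ^ i))
      fun b hb => by rw [(Finset.mem_filter.1 hb).2], Finset.sum_const,
      hcard j (Finset.mem_range.1 hj), nsmul_eq_mul]
    push_cast
    rfl
  rw [Finset.sum_congr rfl hfiber, ← sum_two_pow_mul_one_sub, Finset.sum_mul,
    ← Finset.sum_subset (Finset.range_subset_range.2 hi)]
  · refine Finset.sum_congr rfl fun j hj => ?_
    rw [max_eq_right]
    · ring
    · rw [sub_nonneg, div_le_one (by positivity)]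
      exact pow_le_pow_right₀ one_le_two (Finset.mem_range.1 hj).le
  · intro j _ hj
    rw [max_eq_left, mul_zero]
    rw [sub_nonpos, one_le_div (by positivity)]
    exact pow_le_pow_right₀ one_le_two (by simpa using hj)

/-- **Concentration of the high-bidder counts in the uniform construction.**
With `L = 2^{5n}`, `N = (2ⁿ-1)L` independent bidders, where for each `j < n` exactly
`2ʲL` bidders are uniform on `[0,2^{-j}]`, and `b_i(v) = #{b : v b > 2^{-i}}`, the
probability that some `i ∈ {1,…,n-1}` has `b_i ≤ (2/3·2ⁱ - 1)L + 1` is at most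
`n·e^{-2^{n-2}}`. -/
theorem high_bidder_concentration
    (n : ℕ) (hn : 1 ≤ n) (L N : ℕ)
    (hL : L = 2 ^ (5 * n)) (hN : N = (2 ^ n - 1) * L)
    (grp : Fin N → ℕ) (hgrp : ∀ b, grp b < n)
    (hcard : ∀ j < n, (Finset.univ.filter fun b => grp b = j).card = 2 ^ j * L)
    (F : Fin N → Measure ℝ)
    (hF : ∀ b, F b = ((2 : ℝ≥0∞) ^ grp b) •
        (volume.restrict (Set.Icc (0 : ℝ) (((2 : ℝ) ^ grp b)⁻¹)))) :
    Measure.pi F {v | ∃ i : ℕ, 1 ≤ i ∧ i ≤ n - 1 ∧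
        (((Finset.univ.filter fun b => ((2 : ℝ) ^ i)⁻¹ < v b).card : ℝ) ≤
          (2 / 3 * 2 ^ i - 1) * L + 1)} ≤
      ENNReal.ofReal (n * Real.exp (-(2 : ℝ) ^ ((n : ℤ) - 2))) := by
  have hprob (b : Fin N) : IsProbabilityMeasure (F b) :=
    hF b ▸ isProbabilityMeasure_uniform (grp b)
  have hsingle (i : ℕ) (hi1 : 1 ≤ i) (hin : i ≤ n - 1) :
      Measure.pi F {v | ((Finset.univ.filter fun b => ((2 : ℝ) ^ i)⁻¹ < v b).card : ℝ) ≤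
        (2 / 3 * 2 ^ i - 1) * L + 1} ≤
      ENNReal.ofReal (Real.exp (-(2 : ℝ) ^ ((n : ℤ) - 2))) := by
    have hmean : ∑ b, (F b).real (Set.Ioi ((2 : ℝ) ^ i)⁻¹) =
        (2 / 3 * 2 ^ i - 1 + (2 ^ i)⁻¹ / 3) * L := by
      rw [← sum_real_uniform_Ioi grp hgrp hcard (by omega)]
      exact Finset.sum_congr rfl fun b _ => by rw [hF, real_uniform_Ioi]
    have hn2 : (2 : ℝ) ≤ 2 ^ n := by
      simpa using pow_le_pow_right₀ (one_le_two (α := ℝ)) hn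
    have hLR : (L : ℝ) = (2 ^ n) ^ 5 := by rw [hL]; push_cast; ring
    have hNR : (N : ℝ) = (2 ^ n - 1) * (2 ^ n) ^ 5 := by
      rw [hN, Nat.cast_mul, hLR, Nat.cast_sub Nat.one_le_two_pow]
      push_cast
      rfl
    have hinv : (2 : ℝ) / 2 ^ n ≤ (2 ^ i)⁻¹ := by
      rw [div_le_iff₀ (by positivity), inv_mul_eq_div, le_div_iff₀ (by positivity), ← pow_succ']
      exact pow_le_pow_right₀ one_le_two (by omega)
    have hexp : (2 : ℝ) ^ ((n : ℤ) - 2) = 2 ^ n / 4 := by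
      rw [zpow_sub₀ two_ne_zero, zpow_natCast]
      norm_num
    have hdev : (2 ^ n : ℝ) ^ 4 / 2 ≤ (2 ^ i)⁻¹ / 3 * L - 1 := by
      have h1 : (2 : ℝ) / 2 ^ n * L = 2 * (2 ^ n) ^ 4 := by rw [hLR]; field_simp
      have h2 := mul_le_mul_of_nonneg_right hinv (Nat.cast_nonneg (α := ℝ) L)
      have h3 : (2 : ℝ) ^ 4 ≤ (2 ^ n) ^ 4 := by gcongr
      linarith
    have hdev0 : 0 ≤ (2 ^ i : ℝ)⁻¹ / 3 * L - 1 := le_trans (by positivity) hdev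
    have htail := measureReal_card_le_sub_le_exp F (measurableSet_Ioi (a := ((2 : ℝ) ^ i)⁻¹)) hdev0
    rw [hmean, show (2 / 3 * 2 ^ i - 1 + (2 ^ i)⁻¹ / 3) * (L : ℝ) - ((2 ^ i)⁻¹ / 3 * L - 1) =
      (2 / 3 * 2 ^ i - 1) * L + 1 by ring, Fintype.card_fin] at htail
    rw [← ofReal_measureReal]
    refine ENNReal.ofReal_le_ofReal (le_trans (le_of_eq ?_) (htail.trans ?_))
    · congr!
    · rw [Real.exp_le_exp, neg_le_neg_iff, hexp]
      have hNpos : (0 : ℝ) < N := by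
        rw [hNR]
        have : (0 : ℝ) < 2 ^ n - 1 := by linarith
        positivity
      rw [le_div_iff₀ hNpos]
      have hsq : ((2 ^ n : ℝ) ^ 4 / 2) ^ 2 ≤ ((2 ^ i : ℝ)⁻¹ / 3 * L - 1) ^ 2 := by gcongr
      have hN' : (N : ℝ) ≤ (2 ^ n) ^ 6 := by
        rw [hNR]
        nlinarith [pow_pos (two_pos.trans_le hn2) 5]
      calc (2 : ℝ) ^ n / 4 * N ≤ 2 ^ n / 4 * (2 ^ n) ^ 6 := by gcongr
        _ = (2 ^ n) ^ 7 * 1 / 4 := by ring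
        _ ≤ (2 ^ n) ^ 7 * 2 ^ n / 2 := by
          have := pow_pos (two_pos.trans_le hn2) 7
          nlinarith
        _ = 2 * ((2 ^ n : ℝ) ^ 4 / 2) ^ 2 := by ring
        _ ≤ _ := by gcongr
  calc Measure.pi F _ ≤ Measure.pi F (⋃ i ∈ Finset.Icc 1 (n - 1),
        {v | ((Finset.univ.filter fun b => ((2 : ℝ) ^ i)⁻¹ < v b).card : ℝ) ≤
          (2 / 3 * 2 ^ i - 1) * L + 1}) := by
        refine measure_mono fun v hv => ?_
        obtain ⟨i, h1, h2, h⟩ := hv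
        exact Set.mem_biUnion (Finset.mem_coe.2 (Finset.mem_Icc.2 ⟨h1, h2⟩)) h
    _ ≤ ∑ i ∈ Finset.Icc 1 (n - 1), ENNReal.ofReal (Real.exp (-(2 : ℝ) ^ ((n : ℤ) - 2))) :=
        (measure_biUnion_finset_le _ _).trans <| Finset.sum_le_sum fun i hi =>
          hsingle i (Finset.mem_Icc.1 hi).1 (Finset.mem_Icc.1 hi).2
    _ ≤ n * ENNReal.ofReal (Real.exp (-(2 : ℝ) ^ ((n : ℤ) - 2))) := by
        rw [Finset.sum_const, nsmul_eq_mul, Nat.card_Icc]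
        gcongr
        omega
    _ = _ := by rw [ENNReal.ofReal_mul (Nat.cast_nonneg n), ENNReal.ofReal_natCast]
end

section
/- Fix prices $p_1 \ge p_2 \ge \dots \ge p_n \ge 0$ and consider the Decreasing Price Mechanism (DPM). Then: (1) for every bid vector with distinct entries, for every winner (the bidder with the $i$-th highest bid, where $i \le i^*$), the index $\underline{j}(i)$ is well defined, the payment satisfies $p_{\underline{j}(i)} \le p_i \le b_{(i)}$ (ex-post individual rationality), and losers pay $0$; and (2) the mechanism is dominant-strategy incentive compatible: for every valuation vector $v$ with distinct entries, every bidder $i$, and every alternative bid $w$ such that the resulting bid vector still has distinct entries, bidder $i$'s utility (value times allocation minus payment) from bidding $w$ is at most her utility from bidding $v_i$. -/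
open scoped Classical

/-- In the Decreasing Price Mechanism with prices `p` (0-indexed, decreasing),
the bidder ranked `i` (i.e. with the `i`-th highest bid, rank 0 = highest) wins
iff every rank `j ≤ i` meets its price: `p j ≤ b (σ j)`, where `σ` sorts the
bids decreasingly. -/
def dpmWins {n : ℕ} (p b : Fin n → ℝ) (σ : Equiv.Perm (Fin n)) (i : Fin n) : Prop :=
  ∀ j : Fin n, j ≤ i → p j ≤ b (σ j)

/-- `dpmPayIdx p b i` is the payment index `j̲(i)`: the least `j ≥ i` such that
exactly `j + 1` bidders (0-indexed count) bid at least `p j`. -/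
noncomputable def dpmPayIdx {n : ℕ} (p b : Fin n → ℝ) (i : Fin n) : ℕ :=
  sInf {j : ℕ | (i : ℕ) ≤ j ∧ ∃ hj : j < n,
    (Finset.univ.filter fun m => p ⟨j, hj⟩ ≤ b m).card = j + 1}

/-- DPM allocation of bidder `m` (as a bidder label; `σ.symm m` is her rank). -/
noncomputable def dpmAlloc {n : ℕ} (p b : Fin n → ℝ) (σ : Equiv.Perm (Fin n))
    (m : Fin n) : ℝ :=
  if dpmWins p b σ (σ.symm m) then 1 else 0

/-- DPM payment of bidder `m`: a winner pays `p (j̲(rank m))`, a loser pays `0`. -/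
noncomputable def dpmPay {n : ℕ} (p b : Fin n → ℝ) (σ : Equiv.Perm (Fin n))
    (m : Fin n) : ℝ :=
  if h : dpmWins p b σ (σ.symm m) ∧ dpmPayIdx p b (σ.symm m) < n then
    p ⟨dpmPayIdx p b (σ.symm m), h.2⟩
  else 0

theorem le_apply_iff_lt_card_filter {n : ℕ} {b : Fin n → ℝ} {σ : Equiv.Perm (Fin n)}
    (hσ : StrictAnti (b ∘ σ)) (t : ℝ) (j : Fin n) :
    t ≤ b (σ j) ↔ (j : ℕ) < (Finset.univ.filter fun m => t ≤ b m).card := by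
  constructor
  · intro h
    have hsub : (Finset.Iic j).map σ.toEmbedding ⊆ Finset.univ.filter fun m => t ≤ b m := by
      intro x hx
      obtain ⟨k, hk, rfl⟩ := Finset.mem_map.1 hx
      simpa using h.trans (hσ.antitone (Finset.mem_Iic.1 hk))
    have := Finset.card_le_card hsub
    rw [Finset.card_map, Fin.card_Iic] at this
    omega
  · intro h
    by_contra! hlt
    have hsub : (Finset.univ.filter fun m => t ≤ b m) ⊆ (Finset.Iio j).map σ.toEmbedding := by
      intro x hx
      refine Finset.mem_map.2 ⟨σ.symm x, Finset.mem_Iio.2 ?_, by simp⟩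
      refine hσ.lt_iff_gt.1 ?_
      simpa using hlt.trans_le (Finset.mem_filter.1 hx).2
    have := Finset.card_le_card hsub
    rw [Finset.card_map, Fin.card_Iio] at this
    omega

/-- The bidders other than `m` who bid at least `t`. -/
noncomputable def rivalsAbove {n : ℕ} (b : Fin n → ℝ) (m : Fin n) (t : ℝ) : Finset (Fin n) :=
  (Finset.univ.filter fun x => t ≤ b x).erase m

theorem rivalsAbove_update {n : ℕ} (b : Fin n → ℝ) (m : Fin n) (w t : ℝ) :
    rivalsAbove (Function.update b m w) m t = rivalsAbove b m t := by
  ext x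
  by_cases hx : x = m <;> simp [rivalsAbove, hx]

theorem card_filter_eq_card_rivalsAbove_add_one {n : ℕ} {b : Fin n → ℝ} {m : Fin n} {t : ℝ}
    (h : t ≤ b m) :
    (Finset.univ.filter fun x => t ≤ b x).card = (rivalsAbove b m t).card + 1 :=
  (Finset.card_erase_add_one (by simpa using h)).symm

/-- `J` is the least rank at which exactly `J` rivals of `m` meet the price `p J`.
It does not depend on the bid of `m`, and `p J` is the price `m` faces. -/
def IsCriticalRank {n : ℕ} (p b : Fin n → ℝ) (m J : Fin n) : Prop :=
  (rivalsAbove b m (p J)).card = J ∧ ∀ k < J, (k : ℕ) < (rivalsAbove b m (p k)).card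

theorem exists_isCriticalRank {n : ℕ} {p : Fin n → ℝ} (hp : Antitone p) (b : Fin n → ℝ)
    (m : Fin n) : ∃ J, IsCriticalRank p b m J := by
  have hcard (t : ℝ) : (rivalsAbove b m t).card < n := by
    have h : rivalsAbove b m t ⊂ Finset.univ :=
      Finset.ssubset_univ_iff.2 fun h =>
        Finset.notMem_erase m (Finset.univ.filter fun x => t ≤ b x) (h ▸ Finset.mem_univ m :)
    simpa using Finset.card_lt_card h
  have hex : ∃ j : Fin n, (rivalsAbove b m (p j)).card ≤ j :=
    ⟨⟨n - 1, by have := m.2; omega⟩, Nat.le_sub_one_of_lt (hcard _)⟩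
  obtain ⟨J, hJ, hmin⟩ := WellFounded.has_min (wellFounded_lt (α := Fin n))
    {j | (rivalsAbove b m (p j)).card ≤ j} hex
  have hlt : ∀ k < J, (k : ℕ) < (rivalsAbove b m (p k)).card := fun k hk =>
    not_le.1 fun h => hmin k h hk
  refine ⟨J, le_antisymm hJ ?_, hlt⟩
  rcases Nat.eq_zero_or_pos (J : ℕ) with h0 | hpos
  · omega
  · let k : Fin n := ⟨J - 1, by omega⟩
    have hk : k < J := Fin.lt_def.2 (by simp only [k]; omega)
    have hsub : rivalsAbove b m (p k) ⊆ rivalsAbove b m (p J) :=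
      Finset.erase_subset_erase _ <|
        Finset.monotone_filter_right _ fun _ _ hx => (hp hk.le).trans hx
    have h1 := hlt k hk
    have h2 := Finset.card_le_card hsub
    simp only [k] at h1 h2
    omega

namespace IsCriticalRank

variable {n : ℕ} {p b : Fin n → ℝ} {σ : Equiv.Perm (Fin n)} {m J : Fin n}

theorem update (h : IsCriticalRank p b m J) (w : ℝ) :
    IsCriticalRank p (Function.update b m w) m J := by
  simpa only [IsCriticalRank, rivalsAbove_update] using h

theorem card_filter (h : IsCriticalRank p b m J) (hm : p J ≤ b m) :
    (Finset.univ.filter fun x => p J ≤ b x).card = (J : ℕ) + 1 := by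
  rw [card_filter_eq_card_rivalsAbove_add_one hm, h.1]

theorem rank_le (h : IsCriticalRank p b m J) (hσ : StrictAnti (b ∘ σ)) (hm : p J ≤ b m) :
    σ.symm m ≤ J := by
  have := (le_apply_iff_lt_card_filter hσ (p J) (σ.symm m)).1 (by simpa using hm)
  rw [h.card_filter hm] at this
  exact Fin.le_def.2 (by omega)

theorem price_le_of_wins (h : IsCriticalRank p b m J) (hp : Antitone p)
    (hσ : StrictAnti (b ∘ σ)) (hw : dpmWins p b σ (σ.symm m)) : p J ≤ b m := by
  have hr : p (σ.symm m) ≤ b m := by simpa using hw _ le_rfl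
  rcases le_or_gt (σ.symm m) J with hle | hlt
  · exact (hp hle).trans hr
  · by_contra! hm
    have hJ := (le_apply_iff_lt_card_filter hσ (p J) J).1 (hw J hlt.le)
    have hmem : m ∉ Finset.univ.filter fun x => p J ≤ b x := by simpa using hm
    rw [← Finset.erase_eq_of_notMem hmem] at hJ
    exact absurd h.1 hJ.ne'

theorem wins_iff (h : IsCriticalRank p b m J) (hp : Antitone p) (hσ : StrictAnti (b ∘ σ)) :
    dpmWins p b σ (σ.symm m) ↔ p J ≤ b m := by
  refine ⟨h.price_le_of_wins hp hσ, fun hm j hj => ?_⟩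
  rw [le_apply_iff_lt_card_filter hσ]
  rcases (hj.trans (h.rank_le hσ hm)).lt_or_eq with hlt | rfl
  · exact (h.2 j hlt).trans_le (Finset.card_le_card (Finset.erase_subset _ _))
  · rw [h.card_filter hm]
    omega

theorem payIdx_eq (h : IsCriticalRank p b m J) (hp : Antitone p) (hσ : StrictAnti (b ∘ σ))
    (hw : dpmWins p b σ (σ.symm m)) : dpmPayIdx p b (σ.symm m) = J := by
  have hm := h.price_le_of_wins hp hσ hw
  refine IsLeast.csInf_eq ⟨⟨h.rank_le hσ hm, J.2, h.card_filter hm⟩, ?_⟩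
  rintro j ⟨hrj, hj, hcard⟩
  by_contra! hlt
  have hr : p (σ.symm m) ≤ b m := by simpa using hw _ le_rfl
  have hpj : p ⟨j, hj⟩ ≤ b m := (hp (Fin.le_def.2 hrj)).trans hr
  rw [card_filter_eq_card_rivalsAbove_add_one hpj] at hcard
  have := h.2 ⟨j, hj⟩ (Fin.lt_def.2 hlt)
  simp only at this
  omega

theorem pay_eq (h : IsCriticalRank p b m J) (hp : Antitone p) (hσ : StrictAnti (b ∘ σ)) :
    dpmPay p b σ m = if p J ≤ b m then p J else 0 := by
  by_cases hw : dpmWins p b σ (σ.symm m)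
  · simp [dpmPay, hw, h.payIdx_eq hp hσ hw, (h.wins_iff hp hσ).1 hw]
  · simp [dpmPay, hw, mt (h.wins_iff hp hσ).2 hw]

theorem alloc_eq (h : IsCriticalRank p b m J) (hp : Antitone p) (hσ : StrictAnti (b ∘ σ)) :
    dpmAlloc p b σ m = if p J ≤ b m then 1 else 0 := by
  simp [dpmAlloc, h.wins_iff hp hσ]

end IsCriticalRank

/-- **The Decreasing Price Mechanism is ex-post IR and DSIC.**
Fix decreasing nonnegative prices `p`.  For every bid vector with distinct entries
sorted by `σ` (so `b ∘ σ` is strictly decreasing):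
(1) every winner `i` has a well-defined payment index (there is `j ≥ i` with exactly
`j+1` bidders bidding at least `p j`), pays `p (j̲(i)) ≤ p i ≤ b (σ i)`, and losers
get nothing and pay `0`; and
(2) the mechanism is dominant-strategy incentive compatible: no bidder can increase
her utility by bidding `w` instead of her true value (among bid vectors with
distinct entries). -/
theorem dpm_ir_and_dsic (n : ℕ) (p : Fin n → ℝ)
    (hmono : ∀ i j : Fin n, i ≤ j → p j ≤ p i) (hp0 : ∀ i, 0 ≤ p i) :
    ((∀ b : Fin n → ℝ, Function.Injective b →
      ∀ σ : Equiv.Perm (Fin n), StrictAnti (b ∘ σ) →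
      ∀ i : Fin n, dpmWins p b σ i →
        (∃ j : Fin n, i ≤ j ∧
          (Finset.univ.filter fun m => p j ≤ b m).card = (j : ℕ) + 1) ∧
        dpmPay p b σ (σ i) ≤ p i ∧ p i ≤ b (σ i)) ∧
    (∀ b : Fin n → ℝ, Function.Injective b →
      ∀ σ : Equiv.Perm (Fin n), StrictAnti (b ∘ σ) →
      ∀ i : Fin n, ¬ dpmWins p b σ i →
        dpmAlloc p b σ (σ i) = 0 ∧ dpmPay p b σ (σ i) = 0) ∧
    (∀ v : Fin n → ℝ, Function.Injective v →
      ∀ (i : Fin n) (w : ℝ), Function.Injective (Function.update v i w) →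
      ∀ σ σ' : Equiv.Perm (Fin n), StrictAnti (v ∘ σ) →
        StrictAnti ((Function.update v i w) ∘ σ') →
        v i * dpmAlloc p (Function.update v i w) σ' i -
            dpmPay p (Function.update v i w) σ' i ≤
          v i * dpmAlloc p v σ i - dpmPay p v σ i)) := by
  have hp : Antitone p := fun i j => hmono i j
  refine ⟨fun b _ σ hσ i hw => ?_, fun b _ σ hσ i hl => ?_, fun v _ i w _ σ σ' hσ hσ' => ?_⟩
  · obtain ⟨J, hJ⟩ := exists_isCriticalRank hp b (σ i)
    have hw' : dpmWins p b σ (σ.symm (σ i)) := by simpa using hw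
    have hm := hJ.price_le_of_wins hp hσ hw'
    have hle : i ≤ J := by simpa using hJ.rank_le hσ hm
    refine ⟨⟨J, hle, hJ.card_filter hm⟩, ?_, hw i le_rfl⟩
    rw [hJ.pay_eq hp hσ, if_pos hm]
    exact hp hle
  · simp [dpmAlloc, dpmPay, hl]
  · obtain ⟨J, hJ⟩ := exists_isCriticalRank hp v i
    rw [hJ.pay_eq hp hσ, hJ.alloc_eq hp hσ, (hJ.update w).pay_eq hp hσ',
      (hJ.update w).alloc_eq hp hσ']
    split_ifs <;> linarith
end

section
/- There exists an absolute constant $c > 0$ such that for every $k \ge 0$, every $n$, and every $k$-ambiguous profile of independent value distributions $F_1,\dots,F_n$, there exists a symmetric, DSIC, ex-post IR digital-goods mechanism (a Decreasing Price Mechanism for suitably chosen prices) whose expected revenue is at least $\frac{1}{c(k+1)}\sum_{i=1}^n \sup_{p>0} p\cdot\Pr_{F_i}[v_i \ge p]$, i.e., an $O(k)$ approximation to the optimal revenue. -/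
open MeasureTheory
open scoped ENNReal

open ProbabilityTheory Finset

/-- The allocation of the mechanism offering bidder `i` the take-it-or-leave-it price `q v i`. -/
noncomputable def postedAlloc {n : ℕ} (q : (Fin n → ℝ) → Fin n → ℝ) (v : Fin n → ℝ)
    (i : Fin n) : ℝ :=
  if q v i ≤ v i then 1 else 0

/-- The payment of the mechanism offering bidder `i` the take-it-or-leave-it price `q v i`. -/
noncomputable def postedPay {n : ℕ} (q : (Fin n → ℝ) → Fin n → ℝ) (v : Fin n → ℝ)
    (i : Fin n) : ℝ :=
  if q v i ≤ v i then q v i else 0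

/-- Bounded anonymous price offers in which the price of a bidder ignores their own bid. -/
structure IsPriceRule {n : ℕ} (q : (Fin n → ℝ) → Fin n → ℝ) : Prop where
  measurable : ∀ i, Measurable fun v => q v i
  update : ∀ v i w, q (Function.update v i w) i = q v i
  anonymous : ∀ (π : Equiv.Perm (Fin n)) v i, q (v ∘ π) i = q v (π i)
  nonneg : ∀ v i, 0 ≤ q v i
  bounded : ∃ C, ∀ v i, q v i ≤ C

namespace IsPriceRule

variable {n : ℕ} {q : (Fin n → ℝ) → Fin n → ℝ}

theorem measurable_alloc (hq : IsPriceRule q) (i : Fin n) :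
    Measurable fun v => postedAlloc q v i :=
  Measurable.ite (measurableSet_le (hq.measurable i) (measurable_pi_apply i))
    measurable_const measurable_const

theorem measurable_pay (hq : IsPriceRule q) (i : Fin n) :
    Measurable fun v => postedPay q v i :=
  Measurable.ite (measurableSet_le (hq.measurable i) (measurable_pi_apply i))
    (hq.measurable i) measurable_const

theorem pay_nonneg (hq : IsPriceRule q) (v : Fin n → ℝ) (i : Fin n) : 0 ≤ postedPay q v i := by
  unfold postedPay
  split_ifs
  exacts [hq.nonneg v i, le_rfl]

theorem integrable_pay (hq : IsPriceRule q) (μ : Measure (Fin n → ℝ)) [IsFiniteMeasure μ]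
    (i : Fin n) : Integrable (fun v => postedPay q v i) μ := by
  obtain ⟨C, hC⟩ := hq.bounded
  refine Integrable.of_bound (hq.measurable_pay i).aestronglyMeasurable C (ae_of_all _ fun v => ?_)
  rw [Real.norm_of_nonneg (hq.pay_nonneg v i)]
  unfold postedPay
  split_ifs
  exacts [hC v i, (hq.nonneg v i).trans (hC v i)]

theorem validAlloc : ValidAlloc (postedAlloc q) := by
  intro v _ i
  unfold postedAlloc
  split_ifs <;> norm_num

theorem isAnonymous_alloc (hq : IsPriceRule q) : IsAnonymous (postedAlloc q) := by
  intro π v _ i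
  simp [postedAlloc, hq.anonymous]

theorem isAnonymous_pay (hq : IsPriceRule q) : IsAnonymous (postedPay q) := by
  intro π v _ i
  simp [postedPay, hq.anonymous]

theorem isDSIC (hq : IsPriceRule q) : IsDSIC (postedAlloc q) (postedPay q) := by
  intro v _ i w _
  simp only [postedAlloc, postedPay, hq.update, Function.update_self]
  split_ifs <;> linarith

theorem isExPostIR : IsExPostIR (postedAlloc q) (postedPay q) := by
  intro v _ i
  simp only [postedAlloc, postedPay]
  split_ifs <;> linarith

end IsPriceRule

theorem isPriceRule_const {n : ℕ} {p : ℝ} (hp : 0 ≤ p) :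
    IsPriceRule fun (_ : Fin n → ℝ) _ => p :=
  ⟨fun _ => measurable_const, fun _ _ _ => rfl, fun _ _ _ => rfl, fun _ _ => hp,
    ⟨p, fun _ _ => le_rfl⟩⟩

/-- Revenue of a uniform posted price. -/
theorem integral_postedPay_const {n : ℕ} (F : Fin n → Measure ℝ)
    [∀ i, IsProbabilityMeasure (F i)] {p : ℝ} (hp : 0 ≤ p) :
    ∫ v, ∑ i, postedPay (fun _ _ => p) v i ∂(Measure.pi F) =
      ∑ i, p * (F i {x | p ≤ x}).toReal := by
  rw [integral_finsetSum _ fun i _ => (isPriceRule_const hp).integrable_pay _ i]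
  refine Finset.sum_congr rfl fun i _ => ?_
  have hm : MeasurableSet {x : ℝ | p ≤ x} := measurableSet_Ici
  have h1 : (fun v : Fin n → ℝ => postedPay (fun _ _ => p) v i) =
      fun v => ({x : ℝ | p ≤ x}.indicator (fun _ => p)) (Function.eval i v) := by
    ext v
    simp [postedPay, Set.indicator]
  rw [h1, ← integral_map (φ := Function.eval i) (measurable_pi_apply i).aemeasurable,
    (measurePreserving_eval F i).map_eq, integral_indicator_const _ hm]
  · simp [Measure.real, mul_comm]
  · exact (measurable_const.indicator hm).aestronglyMeasurable

section Bounds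

variable {μ : Measure ℝ}

theorem iSup_price_le {R : ℝ} (hR : 0 ≤ R) (h : ∀ p, 0 < p → p * (μ {x | p ≤ x}).toReal ≤ R) :
    ⨆ (p : ℝ) (_ : 0 < p), p * (μ {x | p ≤ x}).toReal ≤ R :=
  Real.iSup_le (fun p => Real.iSup_le (h p) hR) hR

variable [IsProbabilityMeasure μ]

theorem price_mul_le_of_support {a b : ℝ} (ha : 0 ≤ a) (hab : a ≤ b)
    (h : μ (Set.Icc a b)ᶜ = 0) {p : ℝ} (hp : 0 < p) : p * (μ {x | p ≤ x}).toReal ≤ b := by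
  rcases le_or_gt p b with hpb | hpb
  · have : (μ {x | p ≤ x}).toReal ≤ 1 := measureReal_le_one
    nlinarith
  · have : μ {x | p ≤ x} = 0 := measure_mono_null (t := (Set.Icc a b)ᶜ)
      (fun x (hx : p ≤ x) hx' => (hx.trans hx'.2).not_gt hpb) h
    simp [this]
    linarith

theorem le_of_support {a b : ℝ} (h : μ (Set.Icc a b)ᶜ = 0) : a ≤ b := by
  by_contra hab
  rw [Set.Icc_eq_empty hab] at h
  simp at h

theorem measure_Ici_eq_one {a b p : ℝ} (h : μ (Set.Icc a b)ᶜ = 0) (hp : p ≤ a) :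
    (μ {x | p ≤ x}).toReal = 1 := by
  have : μ {x | p ≤ x} = 1 := by
    rw [prob_compl_eq_zero_iff measurableSet_Icc] at h
    refine le_antisymm prob_le_one (h ▸ measure_mono fun x hx => hp.trans hx.1)
  simp [this]

end Bounds

/-- The fraction of thresholds `α l`, with `2 ^ m ≤ l < 2 ^ (m + 1)`, that are at most `x`. -/
noncomputable def levelStat (α : ℕ → ℝ) (m : ℕ) (x : ℝ) : ℝ :=
  (#{l ∈ Ico (2 ^ m) (2 ^ (m + 1)) | α l ≤ x} : ℝ) / 2 ^ m

section LevelStat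

variable {α : ℕ → ℝ} {m : ℕ}

theorem levelStat_nonneg (x : ℝ) : 0 ≤ levelStat α m x := by
  unfold levelStat
  positivity

theorem levelStat_mono : Monotone (levelStat α m) := by
  intro x y hxy
  unfold levelStat
  gcongr with l hl

theorem card_Ico_two_pow : #(Ico (2 ^ m) (2 ^ (m + 1))) = 2 ^ m := by
  rw [Nat.card_Ico, pow_succ]
  omega

theorem levelStat_le_one (x : ℝ) : levelStat α m x ≤ 1 := by
  unfold levelStat
  rw [div_le_one (by positivity)]
  exact_mod_cast (card_filter_le _ _).trans card_Ico_two_pow.le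

theorem levelStat_eq_one (hα : Antitone α) {x : ℝ} (hx : α (2 ^ m) ≤ x) :
    levelStat α m x = 1 := by
  unfold levelStat
  rw [filter_true_of_mem fun l hl => (hα (mem_Ico.1 hl).1).trans hx, card_Ico_two_pow]
  simp

theorem le_of_levelStat_pos (hα : Antitone α) {x : ℝ} (hx : 0 < levelStat α m x) :
    α (2 ^ (m + 1)) ≤ x := by
  by_contra! h
  refine hx.ne' ?_
  unfold levelStat
  rw [filter_false_of_mem fun l hl => not_le.2 (h.trans_le (hα (mem_Ico.1 hl).2.le))]
  simp

theorem levelStat_sub {x y : ℝ} (hxy : x ≤ y) :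
    levelStat α m y - levelStat α m x =
      (#{l ∈ Ico (2 ^ m) (2 ^ (m + 1)) | x < α l ∧ α l ≤ y} : ℝ) / 2 ^ m := by
  unfold levelStat
  rw [← sub_div]
  congr 1
  have h := card_filter_add_card_filter_not (s := {l ∈ Ico (2 ^ m) (2 ^ (m + 1)) | α l ≤ y})
    (fun l => α l ≤ x)
  rw [filter_filter, filter_filter] at h
  have h1 : ({l ∈ Ico (2 ^ m) (2 ^ (m + 1)) | α l ≤ y ∧ α l ≤ x}) =
      {l ∈ Ico (2 ^ m) (2 ^ (m + 1)) | α l ≤ x} :=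
    filter_congr fun l _ => ⟨fun h => h.2, fun h => ⟨h.trans hxy, h⟩⟩
  have h2 : ({l ∈ Ico (2 ^ m) (2 ^ (m + 1)) | α l ≤ y ∧ ¬ α l ≤ x}) =
      {l ∈ Ico (2 ^ m) (2 ^ (m + 1)) | x < α l ∧ α l ≤ y} :=
    filter_congr fun l _ => by rw [not_le, and_comm]
  rw [h1, h2] at h
  rw [← h]
  push_cast
  ring

end LevelStat

/-- The highest price `α (2 ^ (m + 1))`, `m₀ ≤ m ≤ m₀ + N`, whose level statistic over the other
bidders falls below the cutoff `θ m`. -/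
noncomputable def levelPrice {n : ℕ} (α θ : ℕ → ℝ) (m₀ N : ℕ) (v : Fin n → ℝ) (i : Fin n) : ℝ :=
  (range (N + 1)).sup' nonempty_range_add_one fun t =>
    if ∑ j, levelStat α (m₀ + t) (v j) - levelStat α (m₀ + t) (v i) < θ (m₀ + t)
    then α (2 ^ (m₀ + t + 1)) else 0

section LevelPrice

variable {n : ℕ} {α θ : ℕ → ℝ} {m₀ N : ℕ}

theorem isPriceRule_levelPrice (hα : Antitone α) (hα0 : ∀ l, 0 ≤ α l) :
    IsPriceRule (levelPrice (n := n) α θ m₀ N) where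
  measurable i := by
    have hm (m : ℕ) (j : Fin n) : Measurable fun v : Fin n → ℝ => levelStat α m (v j) :=
      levelStat_mono.measurable.comp (measurable_pi_apply j)
    refine Finset.measurable_range_sup'' fun t _ => ?_
    exact Measurable.ite (measurableSet_lt
      ((Finset.measurable_fun_sum _ fun j _ => hm _ j).sub (hm _ i)) measurable_const)
      measurable_const measurable_const
  update v i w := by
    unfold levelPrice
    have h (f : ℝ → ℝ) : ∑ j, f (Function.update v i w j) - f (Function.update v i w i) =
        ∑ j, f (v j) - f (v i) := by
      rw [← sum_erase_eq_sub (mem_univ i), ← sum_erase_eq_sub (mem_univ i)]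
      exact sum_congr rfl fun j hj => by rw [Function.update_of_ne (ne_of_mem_erase hj)]
    simp only [h]
  anonymous π v i := by
    unfold levelPrice
    have h (f : ℝ → ℝ) : ∑ j, f (v (π j)) = ∑ j, f (v j) :=
      Equiv.sum_comp π fun j => f (v j)
    simp only [Function.comp_apply, h]
  nonneg v i := by
    refine le_sup'_of_le _ (self_mem_range_succ N) ?_
    split_ifs
    exacts [hα0 _, le_rfl]
  bounded := by
    refine ⟨α 0, fun v i => sup'_le _ _ fun t _ => ?_⟩
    split_ifs
    exacts [hα (Nat.zero_le _), hα0 _]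

/-- When every level statistic is within `1 / 2` of its cutoff's centre, every bidder above the
threshold `α (2 ^ m)` buys, at a price of at least `α (2 ^ (m + 1))`. -/
theorem le_postedPay_levelPrice (hα : Antitone α) {v : Fin n → ℝ} (hv : ∀ i, 0 ≤ v i)
    (hθ : ∀ t ≤ N, |∑ j, levelStat α (m₀ + t) (v j) - (θ (m₀ + t) + 1 / 2)| < 1 / 2)
    {i : Fin n} {t : ℕ} (ht : t ≤ N) (hi : α (2 ^ (m₀ + t)) ≤ v i) :
    α (2 ^ (m₀ + t + 1)) ≤ postedPay (levelPrice α θ m₀ N) v i := by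
  have hle : levelPrice α θ m₀ N v i ≤ v i := by
    refine sup'_le _ _ fun s hs => ?_
    split_ifs with h
    · refine le_of_levelStat_pos hα ?_
      have := (abs_lt.1 (hθ s (Nat.lt_succ_iff.1 (mem_range.1 hs)))).1
      linarith
    · exact hv i
  unfold postedPay
  rw [if_pos hle]
  refine le_sup'_of_le _ (mem_range.2 (Nat.lt_succ_iff.2 ht)) ?_
  rw [if_pos]
  rw [levelStat_eq_one hα hi]
  have := (abs_lt.1 (hθ t ht)).2
  linarith

end LevelPrice

theorem sum_range_four_mul_le {α : ℕ → ℝ} (hα : Antitone α) (N : ℕ) :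
    ∑ l ∈ range (4 * N), α l ≤ 4 * ∑ i ∈ range N, α (4 * i) := by
  induction N with
  | zero => simp
  | succ N ih =>
    rw [sum_range_succ, mul_add 4 N 1, mul_one, sum_range_succ, sum_range_succ, sum_range_succ,
      sum_range_succ]
    have h1 := hα (show 4 * N ≤ 4 * N + 1 by omega)
    have h2 := hα (show 4 * N ≤ 4 * N + 2 by omega)
    have h3 := hα (show 4 * N ≤ 4 * N + 3 by omega)
    linarith

theorem sum_range_two_pow_le {α : ℕ → ℝ} (hα : Antitone α) {R : ℝ}
    (hR : ∀ l : ℕ, (l + 1) * α l ≤ R) (hα0 : ∀ l, 0 ≤ α l) (m : ℕ) :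
    ∑ l ∈ range (2 ^ m), α l ≤ (m + 1) * R := by
  induction m with
  | zero => simpa using hR 0
  | succ m ih =>
    rw [pow_succ, mul_two, sum_range_add]
    have h1 : ∑ x ∈ range (2 ^ m), α (2 ^ m + x) ≤ 2 ^ m * α (2 ^ m) := by
      refine (sum_le_card_nsmul _ _ _ fun x _ => hα (Nat.le_add_right _ x)).trans ?_
      simp
    have h2 := hR (2 ^ m)
    have h3 := hα0 (2 ^ m)
    push_cast at h2 ⊢
    linarith

section Ambiguous

variable {k n : ℕ} {F : Fin n → Measure ℝ} {a b : Fin n → ℝ}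

/-- A finite sequence extended by zero. -/
noncomputable def extendZero (a : Fin n → ℝ) (l : ℕ) : ℝ := if h : l < n then a ⟨l, h⟩ else 0

theorem extendZero_val (i : Fin n) : extendZero a i = a i := by simp [extendZero]

theorem extendZero_nonneg (ha : ∀ i, 0 ≤ a i) (l : ℕ) : 0 ≤ extendZero a l := by
  unfold extendZero
  split_ifs
  exacts [ha _, le_rfl]

theorem extendZero_antitone (ha : ∀ i, 0 ≤ a i) (hanti : ∀ i j : Fin n, i ≤ j → a j ≤ a i) :
    Antitone (extendZero a) := by
  intro l l' h
  unfold extendZero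
  split_ifs with h1 h2
  · exact hanti _ _ h
  · omega
  · exact ha _
  · exact le_rfl

theorem mem_of_between (ha : ∀ i, 0 ≤ a i) (hanti : ∀ i j : Fin n, i ≤ j → a j ≤ a i)
    (hk : ∀ i j : Fin n, (j : ℕ) + k + 1 ≤ (i : ℕ) → b i < a j) {i : Fin n} {l : ℕ}
    (h1 : a i < extendZero a l) (h2 : extendZero a l ≤ b i) : l < i ∧ (i : ℕ) ≤ l + k := by
  have hl : l < i := by
    by_contra! h
    have := extendZero_antitone ha hanti h
    rw [extendZero_val] at this
    linarith
  refine ⟨hl, ?_⟩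
  by_contra! h
  have := hk i ⟨l, hl.trans i.2⟩ (by simp; omega)
  rw [extendZero, dif_pos (hl.trans i.2)] at h2
  linarith

/-- The level statistics concentrate: bidders move only few thresholds of each level. -/
theorem sum_levelStat_range_sq_le (ha : ∀ i, 0 ≤ a i)
    (hanti : ∀ i j : Fin n, i ≤ j → a j ≤ a i) (hab : ∀ i, a i ≤ b i)
    (hk : ∀ i j : Fin n, (j : ℕ) + k + 1 ≤ (i : ℕ) → b i < a j) (m : ℕ) :
    ∑ i, (levelStat (extendZero a) m (b i) - levelStat (extendZero a) m (a i)) ^ 2 ≤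
      (k : ℝ) ^ 2 / 2 ^ m := by
  set L := Ico (2 ^ m) (2 ^ (m + 1)) with hL
  set d : Fin n → ℕ := fun i => #{l ∈ L | a i < extendZero a l ∧ extendZero a l ≤ b i} with hd
  have hd1 : ∀ i, d i ≤ k := fun i => by
    refine (card_le_card (t := Ico ((i : ℕ) - k) i) fun l hl => ?_).trans ?_
    · obtain ⟨_, h1, h2⟩ := mem_filter.1 hl
      have := mem_of_between ha hanti hk h1 h2
      rw [mem_Ico]
      omega
    · rw [Nat.card_Ico]
      omega
  have hd2 : ∑ i, d i ≤ 2 ^ m * k := by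
    simp only [hd, card_filter]
    rw [sum_comm, ← card_Ico_two_pow, ← smul_eq_mul]
    refine sum_le_card_nsmul _ _ _ fun l _ => ?_
    rw [← card_filter]
    have : #{i : Fin n | a i < extendZero a l ∧ extendZero a l ≤ b i} ≤ #(Ioc l (l + k)) := by
      refine card_le_card_of_injOn (fun i => (i : ℕ)) (fun i hi => ?_)
        (fun i _ j _ h => Fin.ext h)
      obtain ⟨_, h1, h2⟩ := mem_filter.1 hi
      simpa using mem_of_between ha hanti hk h1 h2
    simpa using this
  have hd3 : ∑ i, (d i : ℝ) ≤ 2 ^ m * k := by exact_mod_cast hd2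
  calc ∑ i, (levelStat (extendZero a) m (b i) - levelStat (extendZero a) m (a i)) ^ 2
      = ∑ i, ((d i : ℝ) / 2 ^ m) ^ 2 := sum_congr rfl fun i _ => by rw [levelStat_sub (hab i)]
    _ ≤ ∑ i, (d i : ℝ) * (k / (2 ^ m) ^ 2) := sum_le_sum fun i _ => by
        have : (d i : ℝ) ≤ k := by exact_mod_cast hd1 i
        rw [div_pow, ← mul_div_assoc, sq]
        gcongr
    _ ≤ (2 ^ m * k) * (k / (2 ^ m) ^ 2) := by
        rw [← sum_mul]
        gcongr
    _ = (k : ℝ) ^ 2 / 2 ^ m := by field_simp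

variable [∀ i, IsProbabilityMeasure (F i)]

theorem ae_pi_mem_Icc (hF : ∀ i, F i (Set.Icc (a i) (b i))ᶜ = 0) :
    ∀ᵐ v ∂(Measure.pi F), ∀ i, v i ∈ Set.Icc (a i) (b i) := by
  rw [ae_all_iff]
  intro i
  have : ∀ᵐ x ∂(F i), x ∈ Set.Icc (a i) (b i) := hF i
  exact (measurePreserving_eval F i).quasiMeasurePreserving.ae this

theorem measure_levelStat_deviation_le (ha : ∀ i, 0 ≤ a i)
    (hanti : ∀ i j : Fin n, i ≤ j → a j ≤ a i)
    (hF : ∀ i, F i (Set.Icc (a i) (b i))ᶜ = 0)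
    (hk : ∀ i j : Fin n, (j : ℕ) + k + 1 ≤ (i : ℕ) → b i < a j) (m : ℕ) :
    (Measure.pi F).real {v | 1 / 2 ≤ |∑ j, levelStat (extendZero a) m (v j) -
      ∫ w, ∑ j, levelStat (extendZero a) m (w j) ∂(Measure.pi F)|} ≤ (k : ℝ) ^ 2 / 2 ^ m := by
  set h := levelStat (extendZero a) m
  have hmeas : Measurable h := levelStat_mono.measurable
  have hbd : ∀ x, ‖h x‖ ≤ 1 := fun x => by
    rw [Real.norm_of_nonneg (levelStat_nonneg x)]
    exact levelStat_le_one x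
  have hLp : ∀ i, MemLp h 2 (F i) := fun i =>
    MemLp.of_bound hmeas.aestronglyMeasurable 1 (ae_of_all _ hbd)
  have hLp' : MemLp (fun v : Fin n → ℝ => ∑ j, h (v j)) 2 (Measure.pi F) :=
    memLp_finsetSum _ fun i _ => (hLp i).comp_measurePreserving (measurePreserving_eval F i)
  have hvar : Var[fun v : Fin n → ℝ => ∑ j, h (v j); Measure.pi F] ≤
      ((k : ℝ) ^ 2 / 2 ^ m) / 4 := by
    have h1 := variance_sum_pi (X := fun _ => h) hLp
    have h2 : (∑ i, fun v : Fin n → ℝ => h (v i)) = fun v => ∑ i, h (v i) := by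
      ext v
      simp
    rw [h2] at h1
    rw [h1]
    calc ∑ i, Var[h; F i] ≤ ∑ i, ((h (b i) - h (a i)) / 2) ^ 2 := by
          refine sum_le_sum fun i _ => variance_le_sq_of_bounded ?_ hmeas.aemeasurable
          have : ∀ᵐ x ∂(F i), x ∈ Set.Icc (a i) (b i) := hF i
          filter_upwards [this] with x hx
          exact ⟨levelStat_mono hx.1, levelStat_mono hx.2⟩
      _ = (∑ i, (h (b i) - h (a i)) ^ 2) / 4 := by
          rw [sum_div]
          exact sum_congr rfl fun i _ => by ring
      _ ≤ _ := by
          gcongr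
          exact sum_levelStat_range_sq_le ha hanti (fun i => le_of_support (hF i)) hk m
  refine ENNReal.toReal_le_of_le_ofReal (by positivity)
    ((meas_ge_le_variance_div_sq hLp' (c := 1 / 2) (by norm_num)).trans
      (ENNReal.ofReal_le_ofReal ?_))
  rw [div_le_iff₀ (by norm_num)]
  linarith

theorem sum_sq_div_two_pow_le (k N : ℕ) :
    ∑ t ∈ range (N + 1), (k : ℝ) ^ 2 / 2 ^ (2 * k + 2 + t) ≤ 1 / 2 := by
  have hk : (k : ℝ) ≤ 2 ^ k := by exact_mod_cast Nat.lt_two_pow_self.le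
  have hterm : ∀ t : ℕ, (k : ℝ) ^ 2 / 2 ^ (2 * k + 2 + t) ≤ 1 / 4 * (1 / 2) ^ t := fun t => by
    rw [div_le_iff₀ (by positivity), one_div_pow, pow_add, pow_add, mul_comm 2 k, pow_mul]
    have : (k : ℝ) ^ 2 ≤ (2 ^ k) ^ 2 := by gcongr
    field_simp
    linarith
  refine (sum_le_sum fun t _ => hterm t).trans ?_
  rw [← mul_sum]
  have h := Summable.sum_le_tsum (range (N + 1)) (fun t _ => by positivity)
    summable_geometric_two
  rw [tsum_geometric_two] at h
  linarith

/-- The level-price mechanism earns a constant fraction of the thresholds of high enough index. -/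
theorem exists_priceRule_sum_le (ha : ∀ i, 0 ≤ a i)
    (hanti : ∀ i j : Fin n, i ≤ j → a j ≤ a i)
    (hF : ∀ i, F i (Set.Icc (a i) (b i))ᶜ = 0)
    (hk : ∀ i j : Fin n, (j : ℕ) + k + 1 ≤ (i : ℕ) → b i < a j) :
    ∃ q : (Fin n → ℝ) → Fin n → ℝ, IsPriceRule q ∧
      (1 / 2) * ∑ i ∈ range n with 2 ^ (2 * k + 2) ≤ i, extendZero a (4 * i) ≤
        ∫ v, ∑ i, postedPay q v i ∂(Measure.pi F) := by
  set α := extendZero a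
  set ν := Measure.pi F
  set m₀ := 2 * k + 2
  have hα : Antitone α := extendZero_antitone ha hanti
  have hα0 : ∀ l, 0 ≤ α l := extendZero_nonneg ha
  set S : ℕ → (Fin n → ℝ) → ℝ := fun m v => ∑ j, levelStat α m (v j)
  set θ : ℕ → ℝ := fun m => (∫ w, S m w ∂ν) - 1 / 2
  have hq := isPriceRule_levelPrice (n := n) (θ := θ) (m₀ := m₀) (N := n) hα hα0
  refine ⟨_, hq, ?_⟩
  set W := ∑ i ∈ range n with 2 ^ m₀ ≤ i, α (4 * i)
  have hW : 0 ≤ W := sum_nonneg fun i _ => hα0 _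
  set B : Set (Fin n → ℝ) := ⋃ t ∈ range (n + 1),
    {v | 1 / 2 ≤ |S (m₀ + t) v - ∫ w, S (m₀ + t) w ∂ν|}
  have hS (m : ℕ) : Measurable (S m) := Finset.measurable_fun_sum _ fun j _ =>
    levelStat_mono.measurable.comp (measurable_pi_apply j)
  have hBm : MeasurableSet B := Finset.measurableSet_biUnion _ fun t _ =>
    measurableSet_le measurable_const ((hS _).sub_const _).abs
  have hB : ν.real B ≤ 1 / 2 :=
    (measureReal_biUnion_finset_le _ _).trans ((sum_le_sum fun t _ =>
      measure_levelStat_deviation_le ha hanti hF hk (m₀ + t)).trans (sum_sq_div_two_pow_le k n))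
  have hBc : 1 / 2 ≤ ν.real Bᶜ := by
    rw [probReal_compl_eq_one_sub hBm]
    linarith
  have hint : Integrable (fun v => ∑ i, postedPay (levelPrice α θ m₀ n) v i) ν :=
    integrable_finsetSum _ fun i _ => hq.integrable_pay _ i
  calc (1 / 2) * W ≤ ν.real Bᶜ * W := by gcongr
    _ = ∫ v, Bᶜ.indicator (fun _ => W) v ∂ν := by
        rw [integral_indicator_const _ hBm.compl, smul_eq_mul]
    _ ≤ _ := by
        refine integral_mono_ae ((integrable_const W).indicator hBm.compl) hint ?_
        filter_upwards [ae_pi_mem_Icc hF] with v hv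
        by_cases hvB : v ∈ B
        · simpa [hvB] using sum_nonneg fun i _ => hq.pay_nonneg v i
        rw [Set.indicator_of_mem hvB]
        have hdev : ∀ t ≤ n, |∑ j, levelStat α (m₀ + t) (v j) - (θ (m₀ + t) + 1 / 2)| < 1 / 2 := by
          intro t ht
          by_contra! h
          refine hvB (Set.mem_biUnion (mem_coe.2 (mem_range.2 (Nat.lt_succ_iff.2 ht))) ?_)
          simpa [θ] using h
        have hpay : ∀ i : Fin n, 2 ^ m₀ ≤ (i : ℕ) →
            α (4 * i) ≤ postedPay (levelPrice α θ m₀ n) v i := by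
          intro i hi
          have hi0 : (i : ℕ) ≠ 0 := (lt_of_lt_of_le (by positivity) hi).ne'
          have hlog : m₀ ≤ Nat.log 2 i := Nat.le_log_of_pow_le (by norm_num) hi
          obtain ⟨t, ht⟩ := Nat.exists_eq_add_of_le (hlog.trans (Nat.le_succ _))
          have hlt : (i : ℕ) < 2 ^ (m₀ + t) := ht ▸ Nat.lt_pow_succ_log_self (by norm_num) _
          have hle : 2 ^ (m₀ + t + 1) ≤ 4 * (i : ℕ) := by
            rw [← ht, Nat.succ_eq_add_one, pow_succ, pow_succ]
            have := Nat.pow_log_le_self 2 hi0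
            omega
          have htn : t ≤ n := by
            have h1 : Nat.log 2 (i : ℕ) < i := Nat.log_lt_self 2 hi0
            have := i.2
            omega
          refine (hα hle).trans (le_postedPay_levelPrice hα
            (fun j => (ha j).trans (hv j).1) hdev htn ?_)
          refine (hα hlt.le).trans ?_
          exact (extendZero_val i).trans_le (hv i).1
        calc W = ∑ i : Fin n, if 2 ^ m₀ ≤ (i : ℕ) then α (4 * i) else 0 := by
              rw [Fin.sum_univ_eq_sum_range (fun i => if 2 ^ m₀ ≤ i then α (4 * i) else 0),
                ← sum_filter]
          _ ≤ _ := sum_le_sum fun i _ => by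
              split_ifs with h
              exacts [hpay i h, hq.pay_nonneg v i]

/-- The benchmark is controlled by uniform posted prices and the thresholds of high index. -/
theorem sum_iSup_price_le (ha : ∀ i, 0 ≤ a i)
    (hanti : ∀ i j : Fin n, i ≤ j → a j ≤ a i)
    (hF : ∀ i, F i (Set.Icc (a i) (b i))ᶜ = 0)
    (hk : ∀ i j : Fin n, (j : ℕ) + k + 1 ≤ (i : ℕ) → b i < a j) {R : ℝ} (hR : 0 ≤ R)
    (hprice : ∀ p, 0 < p → ∑ i, p * (F i {x | p ≤ x}).toReal ≤ R) :
    ∑ i, ⨆ (p : ℝ) (_ : 0 < p), p * ((F i) {x | p ≤ x}).toReal ≤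
      17 * (k + 1) * R +
        4 * ∑ i ∈ range n with 2 ^ (2 * k + 2) ≤ i, extendZero a (4 * i) := by
  set α := extendZero a
  set m₀ := 2 * k + 2 with hm₀
  have hα : Antitone α := extendZero_antitone ha hanti
  have hα0 : ∀ l, 0 ≤ α l := extendZero_nonneg ha
  have hab : ∀ i, a i ≤ b i := fun i => le_of_support (hF i)
  have hone : ∀ i, ⨆ (p : ℝ) (_ : 0 < p), p * ((F i) {x | p ≤ x}).toReal ≤ R := fun i =>
    iSup_price_le hR fun p hp => (single_le_sum
      (f := fun i => p * (F i {x | p ≤ x}).toReal) (fun j _ => by positivity) (mem_univ i)).trans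
      (hprice p hp)
  have hRα : ∀ l : ℕ, (l + 1) * α l ≤ R := by
    intro l
    rcases (hα0 l).eq_or_lt with h0 | h0
    · simpa [← h0] using hR
    have hl : l < n := by
      by_contra h
      simp [α, extendZero, h] at h0
    refine le_trans ?_ (hprice _ h0)
    calc ((l : ℝ) + 1) * α l = ∑ i ∈ Iic (⟨l, hl⟩ : Fin n), α l := by simp
      _ = ∑ i ∈ Iic (⟨l, hl⟩ : Fin n), α l * (F i {x | α l ≤ x}).toReal := by
          refine sum_congr rfl fun i hi => ?_
          rw [measure_Ici_eq_one (hF i), mul_one]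
          rw [← extendZero_val (a := a) i]
          exact hα (Fin.le_def.1 (mem_Iic.1 hi))
      _ ≤ _ := sum_le_sum_of_subset_of_nonneg (subset_univ _) fun i _ _ => by positivity
  have hopt : ∑ i, ⨆ (p : ℝ) (_ : 0 < p), p * ((F i) {x | p ≤ x}).toReal ≤
      (k + 1) * R + ∑ l ∈ range n, α l := by
    calc _ ≤ ∑ i : Fin n, if (i : ℕ) < k + 1 then R else α (i - (k + 1)) := by
          refine sum_le_sum fun i _ => ?_
          split_ifs with h
          · exact hone i
          have hi : (i : ℕ) - (k + 1) < n := by omega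
          refine iSup_price_le (hα0 _) fun p hp =>
            (price_mul_le_of_support (ha i) (hab i) (hF i) hp).trans ?_
          have := hk i ⟨i - (k + 1), hi⟩ (by simp; omega)
          simpa [α, extendZero, hi] using this.le
      _ = ∑ i ∈ range n, if i < k + 1 then R else α (i - (k + 1)) :=
          Fin.sum_univ_eq_sum_range (fun i => if i < k + 1 then R else α (i - (k + 1))) n
      _ ≤ ∑ i ∈ range (k + 1 + n), if i < k + 1 then R else α (i - (k + 1)) := by
          refine sum_le_sum_of_subset_of_nonneg (range_mono (by omega)) fun i _ _ => ?_
          split_ifs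
          exacts [hR, hα0 _]
      _ = _ := by
          rw [sum_range_add]
          congr 1
          · rw [sum_congr rfl fun i hi => if_pos (mem_range.1 hi)]
            simp
          · exact sum_congr rfl fun i _ => by rw [if_neg (by omega), Nat.add_sub_cancel_left]
  have hfour : ∑ l ∈ range n, α l ≤ 4 * ∑ i ∈ range n, α (4 * i) :=
    (sum_le_sum_of_subset_of_nonneg (range_mono (by omega)) fun i _ _ => hα0 i).trans
      (sum_range_four_mul_le hα n)
  have hsplit : ∑ i ∈ range n, α (4 * i) ≤
      (m₀ + 1) * R + ∑ i ∈ range n with 2 ^ m₀ ≤ i, α (4 * i) := by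
    rw [← sum_filter_not_add_sum_filter (range n) (fun i => 2 ^ m₀ ≤ i)]
    gcongr
    refine le_trans ?_ (sum_range_two_pow_le hα hRα hα0 m₀)
    refine (sum_le_sum fun i _ => hα (show i ≤ 4 * i by omega)).trans
      (sum_le_sum_of_subset_of_nonneg (fun i hi => ?_) fun i _ _ => hα0 i)
    simpa using (mem_filter.1 hi).2
  have hm : (m₀ : ℝ) = 2 * k + 2 := by simp [hm₀]
  rw [hm] at hsplit
  have : 0 ≤ k * R := by positivity
  linarith

end Ambiguous

/-- **`O(k)` approximation for `k`-ambiguous distributions.**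
There is an absolute constant `c > 0` such that for every `k`, every `n`, and every
`k`-ambiguous profile of independent value distributions (supports contained in
`[a i, b i]` with `a` decreasing and `b i < a j` whenever `j + k + 1 ≤ i`,
0-indexed), some symmetric, DSIC, ex-post IR digital-goods mechanism extracts at
least a `1/(c(k+1))` fraction of the personalized posted-price optimal revenue. -/
theorem k_ambiguous_O_k_approximation :
    ∃ c : ℝ, 0 < c ∧
      ∀ (k n : ℕ) (F : Fin n → Measure ℝ) (a b : Fin n → ℝ),
        (∀ i, IsProbabilityMeasure (F i)) →
        (∀ i, 0 ≤ a i) →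
        (∀ i j : Fin n, i ≤ j → a j ≤ a i) →
        (∀ i, F i (Set.Icc (a i) (b i))ᶜ = 0) →
        (∀ i j : Fin n, (j : ℕ) + k + 1 ≤ (i : ℕ) → b i < a j) →
        ∃ A P : (Fin n → ℝ) → Fin n → ℝ,
          (∀ i, Measurable fun v => A v i) ∧ (∀ i, Measurable fun v => P v i) ∧
          ValidAlloc A ∧ IsAnonymous A ∧ IsAnonymous P ∧
          IsDSIC A P ∧ IsExPostIR A P ∧
          (1 / (c * (k + 1))) *
              (∑ i, ⨆ (p : ℝ) (_ : 0 < p), p * ((F i) {x | p ≤ x}).toReal) ≤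
            ∫ v, ∑ i, P v i ∂(Measure.pi F) := by
  refine ⟨30, by norm_num, fun k n F a b hprob ha hanti hF hk => ?_⟩
  set OPT := ∑ i, ⨆ (p : ℝ) (_ : 0 < p), p * ((F i) {x | p ≤ x}).toReal with hOPT
  suffices h : ∃ q : (Fin n → ℝ) → Fin n → ℝ, IsPriceRule q ∧
      (1 / (30 * ((k : ℝ) + 1))) * OPT ≤ ∫ v, ∑ i, postedPay q v i ∂(Measure.pi F) by
    obtain ⟨q, hq, h⟩ := h
    exact ⟨postedAlloc q, postedPay q, hq.measurable_alloc, hq.measurable_pay,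
      IsPriceRule.validAlloc, hq.isAnonymous_alloc, hq.isAnonymous_pay, hq.isDSIC,
      IsPriceRule.isExPostIR, h⟩
  set R := (1 / (30 * ((k : ℝ) + 1))) * OPT with hR
  have hOPT0 : 0 ≤ OPT := sum_nonneg fun i _ =>
    Real.iSup_nonneg fun p => Real.iSup_nonneg fun hp => by positivity
  have hR0 : 0 ≤ R := by positivity
  by_cases hprice : ∃ p, 0 < p ∧ R ≤ ∑ i, p * (F i {x | p ≤ x}).toReal
  · obtain ⟨p, hp, h⟩ := hprice
    exact ⟨_, isPriceRule_const hp.le, (integral_postedPay_const F hp.le).symm ▸ h⟩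
  push Not at hprice
  obtain ⟨q, hq, h⟩ := exists_priceRule_sum_le ha hanti hF hk
  refine ⟨q, hq, ?_⟩
  have hbound := sum_iSup_price_le ha hanti hF hk hR0 fun p hp => (hprice p hp).le
  have hOR : OPT = 30 * (k + 1) * R := by
    rw [hR]
    field_simp
  rw [← hOPT, hOR] at hbound
  have : 0 ≤ k * R := by positivity
  linarith
end

section
/- Consider a single buyer of a digital good with value $v$ distributed according to a probability measure $H$ on $[0,\infty)$. Let $a : [0,\infty) \to [0,1]$ and $p : [0,\infty) \to \mathbb{R}$ be measurable functions such that for all $v, w \ge 0$: $v\,a(v) - p(v) \ge v\,a(w) - p(w)$ (DSIC) and $v\,a(v) - p(v) \ge 0$ (ex-post IR). Then the expected revenue satisfies $\int p \, dH \;\le\; \sup_{r > 0} \; r \cdot H([r,\infty))$, i.e., no truthful individually rational selling mechanism for a single buyer can earn more than the best posted price. -/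
open MeasureTheory
open scoped ENNReal

/-- The positive part of a Bochner integral is at most the lower integral of the positive part. -/
lemma ofReal_integral_le_lintegral_ofReal {α : Type*} [MeasurableSpace α] (μ : Measure α)
    (f : α → ℝ) : ENNReal.ofReal (∫ x, f x ∂μ) ≤ ∫⁻ x, ENNReal.ofReal (f x) ∂μ := by
  by_cases hf : Integrable f μ
  · rw [integral_eq_lintegral_pos_part_sub_lintegral_neg_part hf]
    exact (ENNReal.ofReal_le_ofReal (sub_le_self _ ENNReal.toReal_nonneg)).trans
      ENNReal.ofReal_toReal_le
  · simp [integral_undef hf]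

/-- The integral over `[0, v]` of a nonnegative subgradient selection `a` of `u` is at most the
increment of `u`. -/
lemma integral_subgradient_le {u a : ℝ → ℝ}
    (hu : ∀ x y : ℝ, 0 ≤ x → 0 ≤ y → u x + (y - x) * a x ≤ u y)
    (ha : ∀ x : ℝ, 0 ≤ x → 0 ≤ a x) {v : ℝ} (hv : 0 ≤ v) :
    ∫ z in 0..v, a z ≤ u v - u 0 := by
  have hmono : MonotoneOn u (Set.Ici 0) := fun x hx y hy hxy => by
    nlinarith [hu x y hx hy, mul_nonneg (sub_nonneg.2 hxy) (ha x hx)]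
  have hderiv : ∀ᵐ z, z ∈ Set.uIoc 0 v → a z = deriv u z := by
    filter_upwards [(hmono.mono Set.Ioi_subset_Ici_self).ae_differentiableWithinAt_of_mem]
      with z hz hzv
    rw [Set.uIoc_of_le hv] at hzv
    have hdiff : DifferentiableAt ℝ u z := (hz hzv.1).differentiableAt (Ioi_mem_nhds hzv.1)
    have hmin : IsLocalMin (fun y => u y - y * a z) z := by
      filter_upwards [Ioi_mem_nhds hzv.1] with y hy
      linarith [hu z y hzv.1.le (le_of_lt hy)]
    have hd : HasDerivAt (fun y => u y - y * a z) (deriv u z - 1 * a z) z :=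
      hdiff.hasDerivAt.sub ((hasDerivAt_id z).mul_const (a z))
    linarith [hmin.hasDerivAt_eq_zero hd]
  rw [intervalIntegral.integral_congr_ae hderiv]
  have hsub : Set.uIcc 0 v ⊆ Set.Ici 0 := by
    rw [Set.uIcc_of_le hv]
    exact Set.Icc_subset_Ici_self
  have hmem := (hmono.mono hsub).intervalIntegral_deriv_mem_uIcc
  rw [Set.uIcc_of_le (sub_nonneg.2 (hmono (Set.mem_Ici.2 le_rfl) hv hv))] at hmem
  exact hmem.2

/-- Mixing over thresholds `q` uniform on `(0, 1]`, and posting for each `q` the price given by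
the length of `{z ≥ 0 | a z < q}`, extracts from a buyer of value `v` at least the area between
`a` and its value at `v`. -/
lemma ofReal_integral_sub_le_lintegral_threshold {a : ℝ → ℝ} (ha : Measurable a)
    (hrange : ∀ v : ℝ, 0 ≤ v → 0 ≤ a v ∧ a v ≤ 1) {v : ℝ} (hv : 0 ≤ v) :
    ENNReal.ofReal (∫ z in 0..v, (a v - a z)) ≤
      ∫⁻ q in Set.Ioc (0 : ℝ) 1,
        {w | q ≤ a w}.indicator (fun _ => volume {z | 0 ≤ z ∧ a z < q}) v := by
  rw [intervalIntegral.integral_of_le hv]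
  have hmeas : Measurable (Function.uncurry fun z q : ℝ =>
      {x : ℝ × ℝ | a x.1 < x.2 ∧ x.2 ≤ a v}.indicator (fun _ => (1 : ℝ≥0∞)) (z, q)) :=
    measurable_const.indicator ((measurableSet_lt (ha.comp measurable_fst) measurable_snd).inter
      (measurableSet_le measurable_snd measurable_const))
  calc
    _ ≤ ∫⁻ z in Set.Ioc 0 v, ENNReal.ofReal (a v - a z) :=
        ofReal_integral_le_lintegral_ofReal _ _
    _ = ∫⁻ z in Set.Ioc 0 v, ∫⁻ q in Set.Ioc (0 : ℝ) 1,
          {x : ℝ × ℝ | a x.1 < x.2 ∧ x.2 ≤ a v}.indicator (fun _ => (1 : ℝ≥0∞)) (z, q) := by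
        refine setLIntegral_congr_fun measurableSet_Ioc fun z hz => ?_
        have hsub : Set.Ioc (a z) (a v) ⊆ Set.Ioc (0 : ℝ) 1 :=
          Set.Ioc_subset_Ioc (hrange z hz.1.le).1 (hrange v hv).2
        change _ = ∫⁻ q in Set.Ioc (0 : ℝ) 1, (Set.Ioc (a z) (a v)).indicator 1 q
        rw [lintegral_indicator_one measurableSet_Ioc, Measure.restrict_apply measurableSet_Ioc,
          Set.inter_eq_left.2 hsub, Real.volume_Ioc]
    _ = ∫⁻ q in Set.Ioc (0 : ℝ) 1, ∫⁻ z in Set.Ioc 0 v,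
          {x : ℝ × ℝ | a x.1 < x.2 ∧ x.2 ≤ a v}.indicator (fun _ => (1 : ℝ≥0∞)) (z, q) :=
        lintegral_lintegral_swap hmeas.aemeasurable
    _ ≤ _ := by
        refine lintegral_mono fun q => ?_
        by_cases hq : q ≤ a v
        · have hset : MeasurableSet {z | a z < q} := measurableSet_lt ha measurable_const
          rw [Set.indicator_of_mem (by exact hq)]
          have heq : ∀ z, {x : ℝ × ℝ | a x.1 < x.2 ∧ x.2 ≤ a v}.indicator
              (fun _ => (1 : ℝ≥0∞)) (z, q) = {z | a z < q}.indicator 1 z := fun z => by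
            simp [Set.indicator_apply, hq]
          simp_rw [heq]
          rw [lintegral_indicator_one hset, Measure.restrict_apply hset]
          exact measure_mono fun z hz => ⟨hz.2.1.le, hz.1⟩
        · simp [hq]

/-- The price given by the length of `{z ≥ 0 | a z < q}`, charged to every value at which `a` is at
least `q`, earns at most the best posted-price revenue. -/
lemma lintegral_threshold_le_iSup (H : Measure ℝ) (hsupp : H {x | x < 0} = 0) {a : ℝ → ℝ}
    (ha : Measurable a) (hmono : MonotoneOn a (Set.Ici 0)) (q : ℝ) :
    ∫⁻ v, {w | q ≤ a w}.indicator (fun _ => volume {z | 0 ≤ z ∧ a z < q}) v ∂H ≤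
      ⨆ (r : ℝ) (_ : 0 < r), ENNReal.ofReal r * H (Set.Ici r) := by
  rw [lintegral_indicator_const (measurableSet_le measurable_const ha)]
  set t := volume {z | 0 ≤ z ∧ a z < q}
  have hle : ∀ v, 0 ≤ v → q ≤ a v → t ≤ ENNReal.ofReal v := fun v hv hq => by
    have hsub : {z | 0 ≤ z ∧ a z < q} ⊆ Set.Ico 0 v := fun z hz =>
      ⟨hz.1, lt_of_not_ge fun hvz => (hz.2.trans_le hq).not_ge (hmono hv hz.1 hvz)⟩
    simpa using measure_mono (μ := volume) hsub
  have hnonneg : ∀ᵐ v ∂H, 0 ≤ v := by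
    simpa [ae_iff] using hsupp
  by_cases ht_top : t = ∞
  · have hzero : H {w | q ≤ a w} = 0 := by
      refine measure_mono_null (fun v hv => ?_) hsupp
      by_contra hneg
      exact ENNReal.ofReal_ne_top (top_le_iff.1 (ht_top ▸ hle v (not_lt.1 hneg) hv))
    simp [hzero]
  by_cases ht_zero : t = 0
  · simp [ht_zero]
  refine le_trans ?_ (le_iSup₂ t.toReal (ENNReal.toReal_pos ht_zero ht_top))
  rw [ENNReal.ofReal_toReal ht_top]
  gcongr t * ?_
  refine measure_mono_ae ?_
  filter_upwards [hnonneg] with v hv hq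
  exact ENNReal.toReal_le_of_le_ofReal hv (hle v hv hq)

/-- **Single-buyer posted-price optimality.**
For a single buyer with value distribution `H` on `[0,∞)` and any truthful
(`DSIC`), ex-post IR selling mechanism given by an allocation `a : [0,∞) → [0,1]`
and payment `p`, the expected revenue `∫ p dH` is at most the best posted-price
revenue `sup_{r>0} r·H([r,∞))`. -/
theorem single_buyer_posted_price_optimal
    (H : Measure ℝ) (hH : IsProbabilityMeasure H) (hsupp : H {x | x < 0} = 0)
    (a p : ℝ → ℝ) (ha : Measurable a) (hp : Measurable p)
    (hrange : ∀ v : ℝ, 0 ≤ v → 0 ≤ a v ∧ a v ≤ 1)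
    (hDSIC : ∀ v w : ℝ, 0 ≤ v → 0 ≤ w → v * a w - p w ≤ v * a v - p v)
    (hIR : ∀ v : ℝ, 0 ≤ v → 0 ≤ v * a v - p v) :
    ENNReal.ofReal (∫ v, p v ∂H) ≤
      ⨆ (r : ℝ) (_ : 0 < r), ENNReal.ofReal r * H (Set.Ici r) := by
  have hmono : MonotoneOn a (Set.Ici 0) := fun v hv w hw hvw => by
    rcases hvw.eq_or_lt with rfl | hlt
    · exact le_rfl
    · nlinarith [hDSIC v w hv hw, hDSIC w v hw hv]
  have hpay : ∀ v, 0 ≤ v → p v ≤ ∫ z in 0..v, (a v - a z) := fun v hv => by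
    have hsub : Set.uIcc 0 v ⊆ Set.Ici 0 := by
      rw [Set.uIcc_of_le hv]
      exact Set.Icc_subset_Ici_self
    have hint : IntervalIntegrable a volume 0 v := (hmono.mono hsub).intervalIntegrable
    have henv := integral_subgradient_le (u := fun x => x * a x - p x) (a := a)
      (fun x y hx hy => by linarith [hDSIC y x hy hx]) (fun x hx => (hrange x hx).1) hv
    rw [intervalIntegral.integral_sub intervalIntegrable_const hint,
      intervalIntegral.integral_const, smul_eq_mul]
    linarith [hIR 0 le_rfl]
  have hthreshold : Measurable fun q : ℝ => volume {z | 0 ≤ z ∧ a z < q} :=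
    measurable_measure_prodMk_left (s := {x : ℝ × ℝ | 0 ≤ x.2 ∧ a x.2 < x.1})
      ((measurableSet_le measurable_const measurable_snd).inter
        (measurableSet_lt (ha.comp measurable_snd) measurable_fst))
  have hmeas : Measurable (Function.uncurry fun v q : ℝ =>
      {w | q ≤ a w}.indicator (fun _ => volume {z | 0 ≤ z ∧ a z < q}) v) :=
    (hthreshold.comp measurable_snd).indicator
      (measurableSet_le measurable_snd (ha.comp measurable_fst))
  have hnonneg : ∀ᵐ v ∂H, 0 ≤ v := by
    simpa [ae_iff] using hsupp
  calc
    _ ≤ ∫⁻ v, ENNReal.ofReal (p v) ∂H := ofReal_integral_le_lintegral_ofReal _ _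
    _ ≤ ∫⁻ v, (∫⁻ q in Set.Ioc (0 : ℝ) 1,
          {w | q ≤ a w}.indicator (fun _ => volume {z | 0 ≤ z ∧ a z < q}) v) ∂H := by
        refine lintegral_mono_ae ?_
        filter_upwards [hnonneg] with v hv
        exact (ENNReal.ofReal_le_ofReal (hpay v hv)).trans
          (ofReal_integral_sub_le_lintegral_threshold ha hrange hv)
    _ = ∫⁻ q in Set.Ioc (0 : ℝ) 1, ∫⁻ v,
          {w | q ≤ a w}.indicator (fun _ => volume {z | 0 ≤ z ∧ a z < q}) v ∂H :=
        lintegral_lintegral_swap hmeas.aemeasurable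
    _ ≤ ∫⁻ _ in Set.Ioc (0 : ℝ) 1, ⨆ (r : ℝ) (_ : 0 < r), ENNReal.ofReal r * H (Set.Ici r) :=
        lintegral_mono fun q => lintegral_threshold_le_iSup H hsupp ha hmono q
    _ = _ := by simp
end

section
/- Let $F_1,\dots,F_n$ be probability measures on $[0,\infty)$, let $\mu = F_1 \times \dots \times F_n$, and let $g = \frac{1}{n!}\sum_{\pi} \pi_*\mu$ be its symmetrization. Let $\kappa(\cdot \mid v_{-i})$ denote a regular conditional distribution of coordinate $i$ given the remaining coordinates $v_{-i}$ under $g$. Then every symmetric, DSIC, ex-post IR digital-goods mechanism $(A,P)$ (with $A, P$ measurable) has expected revenue bounded by the expected sum of the monopoly revenues of the inferred posteriors: $\int \sum_{i=1}^n P_i(v) \, d\mu(v) \;\le\; \int \sum_{i=1}^n \sup_{p>0} \; p\cdot \kappa([p,\infty) \mid v_{-i}) \, dg(v)$. -/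
open MeasureTheory
open scoped ENNReal

/-- Allocation of the mechanism obtained by dropping the options with nonpositive payment. -/
noncomputable def payingAlloc (a p : ℝ → ℝ) (x : ℝ) : ℝ := if 0 < p x then a x else 0

/-- Weight of the posted price `k * δ` in the grid mixture dominating the payment rule `p`. -/
noncomputable def gridWeight (a p : ℝ → ℝ) (δ : ℝ) (k : ℕ) : ℝ :=
  payingAlloc a p ((k + 1 : ℕ) * δ) - payingAlloc a p (k * δ)

section SingleBidder

variable {a p : ℝ → ℝ}

theorem payingAlloc_mem (ha : ∀ x, 0 ≤ x → 0 ≤ a x ∧ a x ≤ 1) {x : ℝ} (hx : 0 ≤ x) :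
    0 ≤ payingAlloc a p x ∧ payingAlloc a p x ≤ 1 := by
  unfold payingAlloc
  split_ifs
  · exact ha x hx
  · simp

theorem payment_mono (hIC : ∀ x y, 0 ≤ x → 0 ≤ y → a y * x - p y ≤ a x * x - p x)
    {x y : ℝ} (hx : 0 ≤ x) (hxy : x ≤ y) : a x ≤ a y ∧ p x ≤ p y := by
  have h1 := hIC x y hx (hx.trans hxy)
  have h2 := hIC y x (hx.trans hxy) hx
  have h3 : a x ≤ a y := by
    rcases hxy.eq_or_lt with rfl | h
    · rfl
    · by_contra! h4
      nlinarith
  exact ⟨h3, by nlinarith⟩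

theorem payingAlloc_mono (ha : ∀ x, 0 ≤ x → 0 ≤ a x ∧ a x ≤ 1)
    (hIC : ∀ x y, 0 ≤ x → 0 ≤ y → a y * x - p y ≤ a x * x - p x)
    {x y : ℝ} (hx : 0 ≤ x) (hxy : x ≤ y) : payingAlloc a p x ≤ payingAlloc a p y := by
  have h := payment_mono hIC hx hxy
  have h0 := ha y (hx.trans hxy)
  unfold payingAlloc
  split_ifs <;> linarith

theorem posPart_payment_sub_le (hIC : ∀ x y, 0 ≤ x → 0 ≤ y → a y * x - p y ≤ a x * x - p x)
    (hIR : ∀ x, 0 ≤ x → 0 ≤ a x * x - p x) {x y : ℝ} (hx : 0 ≤ x) (hxy : x ≤ y) :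
    max (p y) 0 - max (p x) 0 ≤ y * (payingAlloc a p y - payingAlloc a p x) := by
  have h := payment_mono hIC hx hxy
  have h1 := hIC y x (hx.trans hxy) hx
  have h2 := hIR y (hx.trans hxy)
  unfold payingAlloc
  split_ifs with hy hx' hx'
  · rw [max_eq_left hy.le, max_eq_left hx'.le]; linarith
  · rw [max_eq_left hy.le, max_eq_right (not_lt.1 hx')]; linarith
  · linarith
  · rw [max_eq_right (not_lt.1 hx'), max_eq_right (not_lt.1 hy)]; simp

theorem gridWeight_nonneg (ha : ∀ x, 0 ≤ x → 0 ≤ a x ∧ a x ≤ 1)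
    (hIC : ∀ x y, 0 ≤ x → 0 ≤ y → a y * x - p y ≤ a x * x - p x)
    {δ : ℝ} (hδ : 0 < δ) (k : ℕ) : 0 ≤ gridWeight a p δ k :=
  sub_nonneg.2 (payingAlloc_mono ha hIC (by positivity) (by push_cast; nlinarith))

/-- The positive part of the payment is dominated by a mixture of posted prices on a grid. -/
theorem ofReal_payment_le_tsum (ha : ∀ x, 0 ≤ x → 0 ≤ a x ∧ a x ≤ 1)
    (hIC : ∀ x y, 0 ≤ x → 0 ≤ y → a y * x - p y ≤ a x * x - p x)
    (hIR : ∀ x, 0 ≤ x → 0 ≤ a x * x - p x) {δ : ℝ} (hδ : 0 < δ) (w : ℝ) :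
    ENNReal.ofReal (p (max w 0)) ≤
      ∑' k : ℕ, ENNReal.ofReal ((k + 1 : ℕ) * δ * gridWeight a p δ k) *
        (Set.Ici (k * δ)).indicator 1 w := by
  have hp0 : p 0 ≤ 0 := by simpa using hIR 0 le_rfl
  rcases lt_or_ge w 0 with hw | hw
  · simp [max_eq_right hw.le, ENNReal.ofReal_of_nonpos hp0]
  rw [max_eq_left hw]
  set N := ⌊w / δ⌋₊ + 1 with hN
  have hwN : w ≤ N * δ := by
    rw [← div_le_iff₀ hδ, hN]
    push_cast
    exact (Nat.lt_floor_add_one _).le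
  have hgrid : ∀ m : ℕ, max (p (m * δ)) 0 ≤
      ∑ k ∈ Finset.range m, (k + 1 : ℕ) * δ * gridWeight a p δ k := by
    intro m
    induction m with
    | zero => simp [hp0]
    | succ m ih =>
      rw [Finset.sum_range_succ]
      have := posPart_payment_sub_le hIC hIR (x := m * δ) (y := (m + 1 : ℕ) * δ)
        (by positivity) (by push_cast; nlinarith)
      rw [← gridWeight] at this
      linarith
  calc ENNReal.ofReal (p w)
      ≤ ENNReal.ofReal (∑ k ∈ Finset.range N, (k + 1 : ℕ) * δ * gridWeight a p δ k) :=
        ENNReal.ofReal_le_ofReal <| (payment_mono hIC hw hwN).2.trans <|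
          (le_max_left _ _).trans (hgrid N)
    _ = ∑ k ∈ Finset.range N, ENNReal.ofReal ((k + 1 : ℕ) * δ * gridWeight a p δ k) :=
        ENNReal.ofReal_sum_of_nonneg fun k _ =>
          mul_nonneg (by positivity) (gridWeight_nonneg ha hIC hδ k)
    _ = ∑ k ∈ Finset.range N, ENNReal.ofReal ((k + 1 : ℕ) * δ * gridWeight a p δ k) *
        (Set.Ici (k * δ)).indicator 1 w := by
        refine Finset.sum_congr rfl fun k hk => ?_
        have hk' : (k : ℝ) ≤ w / δ :=
          (Nat.le_floor_iff (by positivity)).1 (Nat.lt_succ_iff.1 (Finset.mem_range.1 hk))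
        rw [Set.indicator_of_mem (Set.mem_Ici.2 ((le_div_iff₀ hδ).1 hk'))]
        simp
    _ ≤ _ := ENNReal.sum_le_tsum _

/-- Posted-price revenue of the grid mixture is at most the monopoly revenue plus the mesh. -/
theorem tsum_gridWeight_le (ha : ∀ x, 0 ≤ x → 0 ≤ a x ∧ a x ≤ 1)
    (hIC : ∀ x y, 0 ≤ x → 0 ≤ y → a y * x - p y ≤ a x * x - p x)
    {δ : ℝ} (hδ : 0 < δ) (ν : Measure ℝ) [IsProbabilityMeasure ν] :
    ∑' k : ℕ, ENNReal.ofReal ((k + 1 : ℕ) * δ * gridWeight a p δ k) * ν (Set.Ici (k * δ)) ≤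
      (⨆ (r : ℝ) (_ : 0 < r), ENNReal.ofReal r * ν (Set.Ici r)) + ENNReal.ofReal δ := by
  set R := ⨆ (r : ℝ) (_ : 0 < r), ENNReal.ofReal r * ν (Set.Ici r)
  have hnn := gridWeight_nonneg (p := p) ha hIC hδ
  have hR : ∀ r : ℝ, 0 ≤ r → ENNReal.ofReal r * ν (Set.Ici r) ≤ R := by
    intro r hr
    rcases hr.eq_or_lt with rfl | h
    · simp
    · exact le_iSup₂_of_le r h le_rfl
  have hterm : ∀ k : ℕ, ENNReal.ofReal ((k + 1 : ℕ) * δ * gridWeight a p δ k) *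
      ν (Set.Ici (k * δ)) ≤ ENNReal.ofReal (gridWeight a p δ k) * (R + ENNReal.ofReal δ) := by
    intro k
    have h1 : ENNReal.ofReal ((k + 1 : ℕ) * δ) * ν (Set.Ici (k * δ)) ≤ R + ENNReal.ofReal δ := by
      have : ((k + 1 : ℕ) : ℝ) * δ = k * δ + δ := by push_cast; ring
      rw [this, ENNReal.ofReal_add (by positivity) hδ.le, add_mul]
      exact add_le_add (hR _ (by positivity)) (mul_le_of_le_one_right' prob_le_one)
    rw [mul_comm (((k + 1 : ℕ) : ℝ) * δ), ENNReal.ofReal_mul (hnn k), mul_assoc]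
    gcongr
  have hsum : ∑' k : ℕ, ENNReal.ofReal (gridWeight a p δ k) ≤ 1 := by
    refine ENNReal.tsum_le_of_sum_range_le fun N => ?_
    rw [← ENNReal.ofReal_sum_of_nonneg fun k _ => hnn k]
    unfold gridWeight
    rw [Finset.sum_range_sub (fun k : ℕ => payingAlloc a p (k * δ)), ENNReal.ofReal_le_one]
    have h1 := payingAlloc_mem (p := p) ha (x := N * δ) (by positivity)
    have h2 := payingAlloc_mem (p := p) ha (x := (0 : ℕ) * δ) (by simp)
    linarith
  calc _ ≤ ∑' k : ℕ, ENNReal.ofReal (gridWeight a p δ k) * (R + ENNReal.ofReal δ) :=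
        ENNReal.tsum_le_tsum hterm
    _ = (∑' k : ℕ, ENNReal.ofReal (gridWeight a p δ k)) * (R + ENNReal.ofReal δ) :=
        ENNReal.tsum_mul_right
    _ ≤ _ := mul_le_of_le_one_left' hsum

end SingleBidder

theorem sum_lintegral_le {α ι : Type*} [MeasurableSpace α] (μ : Measure α) (s : Finset ι)
    (f : ι → α → ℝ≥0∞) : ∑ i ∈ s, ∫⁻ x, f i x ∂μ ≤ ∫⁻ x, ∑ i ∈ s, f i x ∂μ := by
  classical
  induction s using Finset.induction_on with
  | empty => simp
  | insert i s hi ih =>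
    simp only [Finset.sum_insert hi]
    exact (add_le_add_right ih _).trans (le_lintegral_add _ _)

theorem ofReal_integral_le_lintegral {α : Type*} [MeasurableSpace α] {μ : Measure α} (f : α → ℝ) :
    ENNReal.ofReal (∫ x, f x ∂μ) ≤ ∫⁻ x, ENNReal.ofReal (f x) ∂μ := by
  by_cases hf : Integrable f μ
  · rw [integral_eq_lintegral_pos_part_sub_lintegral_neg_part hf]
    exact (ENNReal.ofReal_le_ofReal (sub_le_self _ ENNReal.toReal_nonneg)).trans
      ENNReal.ofReal_toReal_le
  · simp [integral_undef hf]

theorem ENNReal.ofReal_sum_le_sum {ι : Type*} (s : Finset ι) (f : ι → ℝ) :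
    ENNReal.ofReal (∑ i ∈ s, f i) ≤ ∑ i ∈ s, ENNReal.ofReal (f i) := by
  classical
  induction s using Finset.induction_on with
  | empty => simp
  | insert i s hi ih =>
    simp only [Finset.sum_insert hi]
    exact ENNReal.ofReal_add_le.trans (add_le_add_right ih _)

/-- Disintegration over events determined by the coordinates other than `i` extends to weights
determined by those coordinates. -/
theorem lintegral_mul_indicator_eq_of_disintegration {n : ℕ} {g : Measure (Fin n → ℝ)} {i : Fin n}
    {s : Set ℝ} (hs : MeasurableSet s) {f : (Fin n → ℝ) → ℝ≥0∞} (hf : Measurable f)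
    (hdis : ∀ t : Set (Fin n → ℝ), MeasurableSet t →
      (∀ v w : Fin n → ℝ, (∀ j, j ≠ i → v j = w j) → (v ∈ t ↔ w ∈ t)) →
      (∫⁻ v in t, f v ∂g) = g (t ∩ {v | v i ∈ s}))
    {c : (Fin n → ℝ) → ℝ≥0∞} (hc : Measurable c)
    (hci : ∀ (v : Fin n → ℝ) (x : ℝ), c (Function.update v i x) = c v) :
    ∫⁻ v, c v * s.indicator 1 (v i) ∂g = ∫⁻ v, c v * f v ∂g := by
  have hs' : MeasurableSet {v : Fin n → ℝ | v i ∈ s} := measurable_pi_apply i hs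
  have hρ : Measurable fun v : Fin n → ℝ => Function.update v i 0 := by fun_prop
  have hmap : (g.restrict {v | v i ∈ s}).map (fun v => Function.update v i 0) =
      (g.withDensity f).map (fun v => Function.update v i 0) := by
    ext t ht
    rw [Measure.map_apply hρ ht, Measure.map_apply hρ ht, Measure.restrict_apply (hρ ht),
      withDensity_apply _ (hρ ht), hdis _ (hρ ht)]
    intro v w hvw
    have : Function.update v i 0 = Function.update w i 0 := by
      ext j
      by_cases hj : j = i
      · subst hj; simp
      · simp [hj, hvw j hj]
    simp [this]
  have hint := congrArg (fun ν => ∫⁻ v, c v ∂ν) hmap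
  simp only [lintegral_map hc hρ, hci] at hint
  rw [lintegral_withDensity_eq_lintegral_mul _ hf hc, ← lintegral_indicator hs'] at hint
  convert hint using 3 with v v
  · by_cases hv : v i ∈ s <;> simp [hv]
  · simp [mul_comm]

/-- Averaging over coordinate permutations preserves the integral of a symmetric function. -/
theorem lintegral_symmetrization {n : ℕ} (μ : Measure (Fin n → ℝ)) {f : (Fin n → ℝ) → ℝ≥0∞}
    (hf : Measurable f) (hsymm : ∀ (π : Equiv.Perm (Fin n)) v, f (v ∘ π) = f v) :
    ∫⁻ v, f v ∂((n.factorial : ℝ≥0∞)⁻¹ •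
      ∑ π : Equiv.Perm (Fin n), Measure.map (fun v => v ∘ π) μ) = ∫⁻ v, f v ∂μ := by
  have hπ : ∀ π : Equiv.Perm (Fin n), Measurable fun v : Fin n → ℝ => v ∘ π := fun π =>
    measurable_pi_lambda _ fun i => measurable_pi_apply (π i)
  rw [lintegral_smul_measure, lintegral_finsetSum_measure]
  simp only [lintegral_map hf (hπ _), hsymm, Finset.sum_const, Finset.card_univ,
    Fintype.card_perm, Fintype.card_fin, nsmul_eq_mul, smul_eq_mul]
  rw [← mul_assoc, ENNReal.inv_mul_cancel (by exact_mod_cast n.factorial_ne_zero)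
    (ENNReal.natCast_ne_top _), one_mul]

/-- A bidder's expected payment is at most the expected monopoly revenue of the posterior. -/
theorem lintegral_payment_le_lintegral_monopoly {n : ℕ} {g : Measure (Fin n → ℝ)}
    [IsProbabilityMeasure g] {i : Fin n} {κ : (Fin n → ℝ) → Measure ℝ}
    (hκprob : ∀ v, IsProbabilityMeasure (κ v))
    (hκmeas : ∀ s : Set ℝ, MeasurableSet s → Measurable fun v => κ v s)
    (hκdisint : ∀ s : Set ℝ, MeasurableSet s → ∀ t : Set (Fin n → ℝ), MeasurableSet t →
      (∀ v w : Fin n → ℝ, (∀ j, j ≠ i → v j = w j) → (v ∈ t ↔ w ∈ t)) →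
      (∫⁻ v in t, κ v s ∂g) = g (t ∩ {v | v i ∈ s}))
    {A P : (Fin n → ℝ) → Fin n → ℝ}
    (hAm : Measurable fun v => A v i) (hPm : Measurable fun v => P v i)
    (hAv : ValidAlloc A) (hDSIC : IsDSIC A P) (hIR : IsExPostIR A P) :
    ∫⁻ v, ENNReal.ofReal (P (fun j => max (v j) 0) i) ∂g ≤
      ∫⁻ v, ⨆ (r : ℝ) (_ : 0 < r), ENNReal.ofReal r * κ v (Set.Ici r) ∂g := by
  let bid : (Fin n → ℝ) → ℝ → Fin n → ℝ := fun v x => Function.update (fun j => max (v j) 0) i x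
  let a : (Fin n → ℝ) → ℝ → ℝ := fun v x => A (bid v x) i
  let p : (Fin n → ℝ) → ℝ → ℝ := fun v x => P (bid v x) i
  have hbid : ∀ v x, 0 ≤ x → NonnegBids (bid v x) := by
    intro v x hx j
    by_cases hj : j = i
    · subst hj; simpa [bid] using hx
    · simp [bid, hj]
  have hbid_i : ∀ v x, bid v x i = x := fun v x => by simp [bid]
  have ha : ∀ v x, 0 ≤ x → 0 ≤ a v x ∧ a v x ≤ 1 := fun v x hx => hAv _ (hbid v x hx) i
  have hIC : ∀ v x y, 0 ≤ x → 0 ≤ y → a v y * x - p v y ≤ a v x * x - p v x := by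
    intro v x y hx hy
    have h := hDSIC _ (hbid v x hx) i y hy
    rw [hbid_i] at h
    simpa [a, p, bid] using h
  have hIR' : ∀ v x, 0 ≤ x → 0 ≤ a v x * x - p v x := by
    intro v x hx
    have h := hIR _ (hbid v x hx) i
    rwa [hbid_i] at h
  have hbidm : ∀ x, Measurable fun v => bid v x := by
    intro x
    fun_prop
  have ham : ∀ x, Measurable fun v => a v x := fun x => hAm.comp (hbidm x)
  have hpm : ∀ x, Measurable fun v => p v x := fun x => hPm.comp (hbidm x)
  have hpam : ∀ x, Measurable fun v => payingAlloc (a v) (p v) x := fun x =>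
    Measurable.ite (measurableSet_lt measurable_const (hpm x)) (ham x) measurable_const
  have hbid_update : ∀ v x, bid (Function.update v i x) = bid v := by
    intro v x
    ext y j
    by_cases hj : j = i
    · subst hj; simp [bid]
    · simp [bid, hj]
  have hpay : ∀ v, P (fun j => max (v j) 0) i = p v (max (v i) 0) := by
    intro v
    have : bid v (max (v i) 0) = fun j => max (v j) 0 :=
      Function.update_eq_self i fun j => max (v j) 0
    simp only [p, this]
  refine ENNReal.le_of_forall_pos_le_add fun ε hε _ => ?_
  have hδ : (0 : ℝ) < ε := hε
  let c : ℕ → (Fin n → ℝ) → ℝ≥0∞ := fun k v =>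
    ENNReal.ofReal ((k + 1 : ℕ) * (ε : ℝ) * gridWeight (a v) (p v) ε k)
  have hcm : ∀ k, Measurable (c k) := fun k =>
    (((hpam _).sub (hpam _)).const_mul _).ennreal_ofReal
  have hcu : ∀ k v x, c k (Function.update v i x) = c k v := by
    intro k v x
    simp only [c, a, p, hbid_update]
  have hind : ∀ k : ℕ, Measurable fun v : Fin n → ℝ =>
      (Set.Ici ((k : ℝ) * ε)).indicator (1 : ℝ → ℝ≥0∞) (v i) := fun k =>
    (measurable_one.indicator measurableSet_Ici).comp (measurable_pi_apply i)
  calc ∫⁻ v, ENNReal.ofReal (P (fun j => max (v j) 0) i) ∂g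
      ≤ ∫⁻ v, ∑' k : ℕ, c k v * (Set.Ici ((k : ℝ) * ε)).indicator 1 (v i) ∂g := by
        refine lintegral_mono fun v => ?_
        rw [hpay]
        exact ofReal_payment_le_tsum (ha v) (hIC v) (hIR' v) hδ (v i)
    _ = ∑' k : ℕ, ∫⁻ v, c k v * (Set.Ici ((k : ℝ) * ε)).indicator 1 (v i) ∂g :=
        lintegral_tsum fun k => ((hcm k).mul (hind k)).aemeasurable
    _ = ∑' k : ℕ, ∫⁻ v, c k v * κ v (Set.Ici ((k : ℝ) * ε)) ∂g :=
        tsum_congr fun k => lintegral_mul_indicator_eq_of_disintegration measurableSet_Ici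
          (hκmeas _ measurableSet_Ici) (hκdisint _ measurableSet_Ici) (hcm k) (hcu k)
    _ = ∫⁻ v, ∑' k : ℕ, c k v * κ v (Set.Ici ((k : ℝ) * ε)) ∂g :=
        (lintegral_tsum fun k => ((hcm k).mul (hκmeas _ measurableSet_Ici)).aemeasurable).symm
    _ ≤ ∫⁻ v, ((⨆ (r : ℝ) (_ : 0 < r), ENNReal.ofReal r * κ v (Set.Ici r)) +
          ENNReal.ofReal ε) ∂g :=
        lintegral_mono fun v => tsum_gridWeight_le (ha v) (hIC v) hδ (κ v)
    _ = _ := by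
        rw [lintegral_add_right _ measurable_const]
        simp

/-- **Revenue of any anonymous mechanism is bounded by the posted-price revenue of
the inferred posteriors.**  Let `μ = F 1 × ⋯ × F n` be a product of value
distributions on `[0,∞)`, `g = (1/n!) Σ_π π_*μ` its symmetrization, and
`κ i (· | v_{-i})` a regular conditional distribution of coordinate `i` given the
other coordinates under `g` (it depends only on `v_{-i}`, is measurable, and
disintegrates `g` over events determined by `v_{-i}`).  Then every symmetric,
DSIC, ex-post IR digital-goods mechanism has expected revenue at most the
`g`-expectation of the sum over bidders of the monopoly (best posted-price)
revenue of the inferred posterior `κ i v`. -/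
theorem anonymous_revenue_le_posterior_posted_prices
    (n : ℕ) (F : Fin n → Measure ℝ) (hF : ∀ i, IsProbabilityMeasure (F i))
    (hFsupp : ∀ i, F i {x | x < 0} = 0)
    (g : Measure (Fin n → ℝ))
    (hg : g = (n.factorial : ℝ≥0∞)⁻¹ •
        ∑ π : Equiv.Perm (Fin n), Measure.map (fun v => v ∘ π) (Measure.pi F))
    (κ : Fin n → (Fin n → ℝ) → Measure ℝ)
    (hκprob : ∀ i v, IsProbabilityMeasure (κ i v))
    (hκmeas : ∀ (i : Fin n) (s : Set ℝ), MeasurableSet s → Measurable fun v => κ i v s)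
    (hκdep : ∀ (i : Fin n) (v w : Fin n → ℝ), (∀ j, j ≠ i → v j = w j) → κ i v = κ i w)
    (hκdisint : ∀ (i : Fin n) (s : Set ℝ), MeasurableSet s →
      ∀ t : Set (Fin n → ℝ), MeasurableSet t →
        (∀ v w : Fin n → ℝ, (∀ j, j ≠ i → v j = w j) → (v ∈ t ↔ w ∈ t)) →
        (∫⁻ v in t, κ i v s ∂g) = g (t ∩ {v | v i ∈ s}))
    (A P : (Fin n → ℝ) → Fin n → ℝ)
    (hAm : ∀ i, Measurable fun v => A v i) (hPm : ∀ i, Measurable fun v => P v i)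
    (hAv : ValidAlloc A) (hAanon : IsAnonymous A) (hPanon : IsAnonymous P)
    (hDSIC : IsDSIC A P) (hIR : IsExPostIR A P) :
    ENNReal.ofReal (∫ v, ∑ i, P v i ∂(Measure.pi F)) ≤
      ∫⁻ v, ∑ i, ⨆ (r : ℝ) (_ : 0 < r), ENNReal.ofReal r * κ i v (Set.Ici r) ∂g := by
  classical
  let pos : (Fin n → ℝ) → Fin n → ℝ := fun v j => max (v j) 0
  have hposm : Measurable pos := by fun_prop
  let f : (Fin n → ℝ) → ℝ≥0∞ := fun v => ∑ i, ENNReal.ofReal (P (pos v) i)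
  have hfm : Measurable f :=
    Finset.measurable_fun_sum _ fun i _ => ((hPm i).comp hposm).ennreal_ofReal
  have hsymm : ∀ (π : Equiv.Perm (Fin n)) v, f (v ∘ π) = f v := by
    intro π v
    have h : ∀ i, P (pos (v ∘ π)) i = P (pos v) (π i) := fun i =>
      hPanon π (pos v) (fun j => le_max_right _ _) i
    simp only [f, h]
    exact Equiv.sum_comp π fun i => ENNReal.ofReal (P (pos v) i)
  have hfg : ∫⁻ v, f v ∂g = ∫⁻ v, f v ∂(Measure.pi F) := by
    rw [hg]
    exact lintegral_symmetrization _ hfm hsymm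
  have hgprob : IsProbabilityMeasure g := by
    refine ⟨?_⟩
    rw [← lintegral_one, hg, lintegral_symmetrization _ measurable_const fun _ _ => rfl]
    simp
  have hpos : ∀ᵐ v ∂(Measure.pi F), pos v = v := by
    have h : ∀ i, ∀ᵐ v ∂(Measure.pi F), 0 ≤ v i := fun i =>
      (measurePreserving_eval F i).quasiMeasurePreserving.ae
        (p := fun x => 0 ≤ x) (by simpa [ae_iff] using hFsupp i)
    filter_upwards [ae_all_iff.2 h] with v hv
    exact funext fun j => max_eq_left (hv j)
  calc ENNReal.ofReal (∫ v, ∑ i, P v i ∂(Measure.pi F))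
      ≤ ∫⁻ v, ENNReal.ofReal (∑ i, P v i) ∂(Measure.pi F) := ofReal_integral_le_lintegral _
    _ ≤ ∫⁻ v, f v ∂(Measure.pi F) := by
        refine lintegral_mono_ae ?_
        filter_upwards [hpos] with v hv
        simp only [f, hv]
        exact ENNReal.ofReal_sum_le_sum _ _
    _ = ∫⁻ v, f v ∂g := hfg.symm
    _ = ∑ i, ∫⁻ v, ENNReal.ofReal (P (pos v) i) ∂g :=
        lintegral_finsetSum _ fun i _ => ((hPm i).comp hposm).ennreal_ofReal
    _ ≤ ∑ i, ∫⁻ v, ⨆ (r : ℝ) (_ : 0 < r), ENNReal.ofReal r * κ i v (Set.Ici r) ∂g :=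
        Finset.sum_le_sum fun i _ => lintegral_payment_le_lintegral_monopoly (hκprob i)
          (hκmeas i) (hκdisint i) (hAm i) (hPm i) hAv hDSIC hIR
    _ ≤ _ := sum_lintegral_le _ _ _
end
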